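/- arXiv:1606.04482 — 3 statements merged into one kernel-verified Lean document; each statement's English description precedes it below -/
import Mathlib

section
/- Suppose h:ℕ→ℝ is a multiplicative function satisfying: (i) there is a constant H ≥ 1 with |h(p^k)| ≤ H^k for all primes p and k ≥ 1, (ii) |h(n)| ≪_ε n^ε for every ε > 0, and (iii) there is α_h > 0 with (1/x)·∑_{p ≤ x} |h(p)| log p ≥ α_h for all sufficiently large x. Then ∑_{n ≤ x, gcd(n, W(x)) = 1} |h(n)| ≍ (x/log x)·∏_{w(x) < p ≤ x} (1 + |h(p)|/p), and for every ε > 0 this quantity is ≫_ε x·(log x)^{α_h − ε − 1}. -/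
open Filter Finset MeasureTheory
open scoped Classical Pointwise

noncomputable section

/-- The set of primes in `[1, x]`. -/
def primesUpTo (x : ℝ) : Finset ℕ := (Finset.Icc 1 ⌊x⌋₊).filter Nat.Prime

/-- The mean value `S_h(x) = (1/x) ∑_{1 ≤ n ≤ x} h(n)`. -/
def Sm (h : ℕ → ℝ) (x : ℝ) : ℝ := (1 / x) * ∑ n ∈ Finset.Icc 1 ⌊x⌋₊, h n

/-- The mean value `S_h(x; q, a) = (q/x) ∑_{1 ≤ n ≤ x, n ≡ a (q)} h(n)`. -/
def SmAP (h : ℕ → ℝ) (x : ℝ) (q : ℕ) (a : ℤ) : ℝ :=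
  ((q : ℝ) / x) * ∑ n ∈ Finset.Icc 1 ⌊x⌋₊,
    if ((n : ℤ) : ZMod q) = (a : ZMod q) then h n else 0

/-- `∏_{p ≤ x, p ∤ q} (1 + |h(p)|/p)`. -/
def ppProd (h : ℕ → ℝ) (x : ℝ) (q : ℕ) : ℝ :=
  ∏ p ∈ (primesUpTo x).filter (fun p => ¬ p ∣ q), (1 + |h p| / p)

/-- `h` is multiplicative. -/
def MultFn (h : ℕ → ℝ) : Prop :=
  h 1 = 1 ∧ ∀ m n : ℕ, Nat.Coprime m n → h (m * n) = h m * h n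

/-- Condition (i) of the class `𝓜`, with explicit constant `H`. -/
def CondI (h : ℕ → ℝ) (H : ℝ) : Prop :=
  1 ≤ H ∧ ∀ p k : ℕ, p.Prime → 1 ≤ k → |h (p ^ k)| ≤ H ^ k

/-- Condition (ii) of the class `𝓜`: `|h(n)| ≪_ε n^ε`. -/
def CondII (h : ℕ → ℝ) : Prop :=
  ∀ ε : ℝ, 0 < ε → ∃ C : ℝ, 0 < C ∧ ∀ n : ℕ, 1 ≤ n → |h n| ≤ C * (n : ℝ) ^ ε

/-- Condition (iii) of the class `𝓜`, with explicit constant `α`. -/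
def CondIII (h : ℕ → ℝ) (α : ℝ) : Prop :=
  0 < α ∧ ∃ x₀ : ℝ, ∀ x ≥ x₀, α ≤ (1 / x) * ∑ p ∈ primesUpTo x, |h p| * Real.log p

/-- Condition (iv) of the class `𝓜`: stability of mean values in progressions. -/
def CondIV (h : ℕ → ℝ) : Prop :=
  ∀ C : ℝ, 0 < C → ∃ φ : ℝ → ℝ, Tendsto φ atTop (nhds 0) ∧
    ∃ K : ℝ, 0 < K ∧ ∃ x₀ : ℝ, ∀ x ≥ x₀, ∀ x' : ℝ, ∀ q : ℕ, ∀ A : ℤ,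
      x * (Real.log x) ^ (-C) < x' → x' < x →
      1 ≤ q → (q : ℝ) < (Real.log x) ^ C → Int.gcd (q : ℤ) A = 1 →
      |SmAP h x' q A - SmAP h x q A| ≤
        K * φ x * ((q : ℝ) / (Nat.totient q : ℝ)) * (1 / Real.log x) * ppProd h x q

/-- The class `𝓜` of multiplicative functions. -/
def MemM (h : ℕ → ℝ) : Prop :=
  MultFn h ∧ (∃ H, CondI h H) ∧ CondII h ∧ (∃ α, CondIII h α) ∧ CondIV h

/-- An admissible choice of the function `w`:
`log log x / log log log x < w(x) ≤ log log x` for all large `x`. -/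
def GoodW (w : ℝ → ℝ) : Prop :=
  ∃ x₀ : ℝ, ∀ x ≥ x₀,
    Real.log (Real.log x) / Real.log (Real.log (Real.log x)) < w x ∧
    w x ≤ Real.log (Real.log x)

/-- `W(x) = ∏_{p ≤ w(x)} p`. -/
def Wprod (w : ℝ → ℝ) (x : ℝ) : ℕ := ∏ p ∈ primesUpTo (w x), p


lemma mem_primesUpTo' {x : ℝ} {p : ℕ} : p ∈ primesUpTo x ↔ p.Prime ∧ (p : ℝ) ≤ x := by
  unfold primesUpTo
  simp only [Finset.mem_filter, Finset.mem_Icc]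
  constructor
  · rintro ⟨⟨h1, h2⟩, h3⟩
    exact ⟨h3, (Nat.le_floor_iff' (by omega)).1 h2⟩
  · rintro ⟨h1, h2⟩
    exact ⟨⟨h1.one_lt.le, (Nat.le_floor_iff' h1.ne_zero).2 h2⟩, h1⟩

lemma coprime_Wprod {w : ℝ → ℝ} {x : ℝ} {n : ℕ} :
    Nat.Coprime n (Wprod w x) ↔ ∀ p : ℕ, p.Prime → p ∣ n → w x < p := by
  unfold Wprod
  rw [Nat.coprime_prod_right_iff]
  constructor
  · intro h p hp hpn
    by_contra hlt
    have := h p (mem_primesUpTo'.2 ⟨hp, not_lt.1 hlt⟩)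
    exact (Nat.Prime.coprime_iff_not_dvd hp).1 this.symm hpn
  · intro h p hp
    have hp' := mem_primesUpTo'.1 hp
    refine ((Nat.Prime.coprime_iff_not_dvd hp'.1).2 fun hd => ?_).symm
    exact absurd (h p hp'.1 hd) (not_lt.2 hp'.2)

lemma sum_log_primeFactors_le {n : ℕ} (hn : n ≠ 0) :
    ∑ p ∈ n.primeFactors, Real.log p ≤ Real.log n := by
  rw [← Real.log_prod]
  · apply Real.log_le_log
    · apply Finset.prod_pos
      intro p hp
      exact_mod_cast (Nat.prime_of_mem_primeFactors hp).pos
    · rw [← Nat.cast_prod]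
      exact_mod_cast Nat.le_of_dvd (Nat.pos_of_ne_zero hn) (Nat.prod_primeFactors_dvd n)
  · intro p hp
    exact_mod_cast (Nat.prime_of_mem_primeFactors hp).ne_zero

lemma log_eq_sum_factorization {n : ℕ} (hn : n ≠ 0) :
    Real.log n = ∑ p ∈ n.primeFactors, (n.factorization p : ℝ) * Real.log p := by
  conv_lhs => rw [← Nat.prod_factorization_pow_eq_self hn]
  rw [Finsupp.prod, Nat.cast_prod, Real.log_prod]
  · simp
  · intro p hp
    have := (Nat.prime_of_mem_primeFactors (by simpa using hp)).ne_zero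
    positivity

lemma sum_log_le_two_mul {x : ℝ} (hx : 0 ≤ x) : ∑ p ∈ primesUpTo x, Real.log p ≤ 2 * x := by
  have h := Chebyshev.theta_le_log4_mul_x hx
  have h4 : Real.log 4 ≤ 2 := by
    have : (4 : ℝ) = 2 ^ 2 := by norm_num
    rw [this, Real.log_pow]
    have := Real.log_two_lt_d9
    push_cast
    linarith
  have : ∑ p ∈ primesUpTo x, Real.log p = Chebyshev.theta x := by
    unfold Chebyshev.theta primesUpTo
    rfl
  rw [this]
  nlinarith

lemma sum_log_div_le {x : ℝ} (hx : 1 ≤ x) :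
    ∑ p ∈ primesUpTo x, Real.log p / p ≤ 2 * Real.log x := by
  set N := ⌊x⌋₊ with hN
  have hN1 : 1 ≤ N := Nat.le_floor (by simpa using hx)
  have hNx : (N : ℝ) ≤ x := Nat.floor_le (by linarith)
  have hN0 : (0 : ℝ) < N := by exact_mod_cast hN1
  have key : ∑ p ∈ primesUpTo x, (N / p : ℕ) * Real.log p ≤ N * Real.log N := by
    calc ∑ p ∈ primesUpTo x, (N / p : ℕ) * Real.log p
        = ∑ p ∈ primesUpTo x, ∑ n ∈ (Finset.Ioc 0 N).filter (fun n => p ∣ n), Real.log p := by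
          refine Finset.sum_congr rfl fun p hp => ?_
          rw [Finset.sum_const, Nat.Ioc_filter_dvd_card_eq_div, nsmul_eq_mul]
      _ = ∑ n ∈ Finset.Ioc 0 N, ∑ p ∈ n.primeFactors, Real.log p := by
          refine Finset.sum_comm' ?_
          intro p n
          simp only [Finset.mem_filter, Finset.mem_Ioc, mem_primesUpTo', Nat.mem_primeFactors]
          constructor
          · rintro ⟨⟨hp, hpx⟩, ⟨h1, h2⟩, h3⟩
            exact ⟨⟨hp, h3, by omega⟩, h1, h2⟩
          · rintro ⟨⟨hp, h3, h0⟩, h1, h2⟩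
            refine ⟨⟨hp, ?_⟩, ⟨h1, h2⟩, h3⟩
            have : p ≤ N := (Nat.le_of_dvd h1 h3).trans h2
            exact le_trans (by exact_mod_cast this) hNx
      _ ≤ ∑ n ∈ Finset.Ioc 0 N, Real.log N := by
          refine Finset.sum_le_sum fun n hn => ?_
          rw [Finset.mem_Ioc] at hn
          refine (sum_log_primeFactors_le (by omega)).trans ?_
          apply Real.log_le_log
          · exact_mod_cast hn.1
          · exact_mod_cast hn.2
      _ = N * Real.log N := by simp
  have h2 : ∑ p ∈ primesUpTo x, (N : ℝ) / 2 * (Real.log p / p) ≤ N * Real.log N := by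
    refine le_trans (Finset.sum_le_sum fun p hp => ?_) key
    obtain ⟨hp, hpx⟩ := mem_primesUpTo'.1 hp
    have hpN : p ≤ N := Nat.le_floor hpx
    have h1 : 1 ≤ N / p := (Nat.one_le_div_iff hp.pos).2 hpN
    have h3 : N < p * (N / p + 1) := Nat.lt_mul_div_succ N hp.pos
    have h3' : (N : ℝ) < p * ((N / p : ℕ) + 1) := by exact_mod_cast h3
    have h1' : (1 : ℝ) ≤ (N / p : ℕ) := by exact_mod_cast h1
    have hp0 : (0 : ℝ) < p := by exact_mod_cast hp.pos
    have hl : 0 ≤ Real.log p := Real.log_natCast_nonneg p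
    have : (N : ℝ) / 2 / p ≤ (N / p : ℕ) := by
      rw [div_le_iff₀ hp0]
      nlinarith
    calc (N : ℝ) / 2 * (Real.log p / p) = (N : ℝ) / 2 / p * Real.log p := by ring
      _ ≤ _ := by gcongr
  rw [← Finset.mul_sum] at h2
  have h3 : ∑ p ∈ primesUpTo x, (Real.log p / p) ≤ 2 * Real.log N := by
    by_contra hc
    push Not at hc
    nlinarith
  have := Real.log_le_log hN0 hNx
  linarith

/-- Primes in `(v, x]`. -/
def PP (v x : ℝ) : Finset ℕ := (primesUpTo x).filter (fun p : ℕ => v < (p : ℝ))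

/-- Integers in `[1, x]` all of whose prime factors exceed `v`. -/
def AA (v x : ℝ) : Finset ℕ :=
  (Finset.Icc 1 ⌊x⌋₊).filter (fun n => ∀ p : ℕ, p.Prime → p ∣ n → v < p)

lemma mem_PP {v x : ℝ} {p : ℕ} : p ∈ PP v x ↔ (p.Prime ∧ (p : ℝ) ≤ x) ∧ v < p := by
  unfold PP
  rw [Finset.mem_filter, mem_primesUpTo']

lemma mem_AA {v x : ℝ} {n : ℕ} :
    n ∈ AA v x ↔ (n ≠ 0 ∧ (n : ℝ) ≤ x) ∧ ∀ p : ℕ, p.Prime → p ∣ n → v < p := by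
  unfold AA
  rw [Finset.mem_filter, Finset.mem_Icc]
  constructor
  · rintro ⟨⟨h1, h2⟩, h3⟩
    exact ⟨⟨by omega, (Nat.le_floor_iff' (by omega)).1 h2⟩, h3⟩
  · rintro ⟨⟨h1, h2⟩, h3⟩
    exact ⟨⟨by omega, (Nat.le_floor_iff' h1).2 h2⟩, h3⟩

lemma sum_le_sum_inj {ι κ : Type*} (s : Finset ι) (t : Finset κ) (e : ι → κ)
    (he : ∀ i ∈ s, e i ∈ t) (inj : Set.InjOn e s) (F : ι → ℝ) (G : κ → ℝ)
    (hG : ∀ k ∈ t, 0 ≤ G k) (hFG : ∀ i ∈ s, F i ≤ G (e i)) : ∑ i ∈ s, F i ≤ ∑ k ∈ t, G k := by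
  calc ∑ i ∈ s, F i ≤ ∑ i ∈ s, G (e i) := Finset.sum_le_sum hFG
    _ = ∑ k ∈ s.image e, G k := (Finset.sum_image inj).symm
    _ ≤ ∑ k ∈ t, G k := by
        refine Finset.sum_le_sum_of_subset_of_nonneg (Finset.image_subset_iff.2 he) ?_
        intro k hk _
        exact hG k hk

/-- The standing assumptions on the nonnegative function `f = |h|`. -/
structure NF (f : ℕ → ℝ) (H : ℝ) : Prop where
  nn : ∀ n, 0 ≤ f n
  one : f 1 = 1
  mul : ∀ m n : ℕ, Nat.Coprime m n → f (m * n) = f m * f n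
  H1 : 1 ≤ H
  pk : ∀ p k : ℕ, p.Prime → 1 ≤ k → f (p ^ k) ≤ H ^ k

lemma NF.p {f : ℕ → ℝ} {H : ℝ} (hf : NF f H) {p : ℕ} (hp : p.Prime) : f p ≤ H := by
  simpa using hf.pk p 1 hp le_rfl

lemma lower1 {f : ℕ → ℝ} {H : ℝ} (hf : NF f H) {α v x z : ℝ} (hz : 1 ≤ z)
    (hzx : z ≤ x) (hv : 0 ≤ v)
    (hc : ∀ y ≥ x / z, α * y ≤ ∑ p ∈ primesUpTo y, f p * Real.log p) (hα : 0 < α)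
    (hb : H * (2 * v + Real.log x) ≤ α / 2 * (x / z)) :
    α / 2 * x * ∑ m ∈ AA v z, f m / m ≤ Real.log x * ∑ n ∈ AA v x, f n := by
  have hH := hf.H1
  have hx1 : 1 ≤ x := hz.trans hzx
  -- inner sums
  have inner : ∀ m ∈ AA v z, α / 2 * (x / m) ≤
      ∑ p ∈ (PP v (x / m)).filter (fun p => ¬ p ∣ m), f p * Real.log p := by
    intro m hm
    obtain ⟨⟨hm0, hmz⟩, hmp⟩ := mem_AA.1 hm
    have hm1 : (1 : ℝ) ≤ m := by exact_mod_cast Nat.one_le_iff_ne_zero.2 hm0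
    have hmx : x / z ≤ x / m := by gcongr
    have h1 := hc (x / m) hmx
    have hsub : ∑ p ∈ primesUpTo (x / m), f p * Real.log p ≤
        ∑ p ∈ (PP v (x / m)).filter (fun p => ¬ p ∣ m), f p * Real.log p +
        (∑ p ∈ primesUpTo v, H * Real.log p + ∑ p ∈ m.primeFactors, H * Real.log p) := by
      have hnn : ∀ p : ℕ, 0 ≤ f p * Real.log p := fun p =>
        mul_nonneg (hf.nn p) (Real.log_natCast_nonneg p)
      have e1 : ∑ p ∈ primesUpTo v, f p * Real.log p ≤ ∑ p ∈ primesUpTo v, H * Real.log p := by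
        refine Finset.sum_le_sum fun p hp => ?_
        exact mul_le_mul_of_nonneg_right (hf.p (mem_primesUpTo'.1 hp).1)
          (Real.log_natCast_nonneg p)
      have e2 : ∑ p ∈ m.primeFactors, f p * Real.log p ≤
          ∑ p ∈ m.primeFactors, H * Real.log p := by
        refine Finset.sum_le_sum fun p hp => ?_
        exact mul_le_mul_of_nonneg_right (hf.p (Nat.prime_of_mem_primeFactors hp))
          (Real.log_natCast_nonneg p)
      have e3 : ∑ p ∈ primesUpTo (x / m), f p * Real.log p ≤
          ∑ p ∈ (PP v (x / m)).filter (fun p => ¬ p ∣ m) ∪ (primesUpTo v ∪ m.primeFactors),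
            f p * Real.log p := by
        refine Finset.sum_le_sum_of_subset_of_nonneg ?_ fun p _ _ => hnn p
        intro p hp
        have hp' := mem_primesUpTo'.1 hp
        simp only [Finset.mem_union, Finset.mem_filter, mem_PP, mem_primesUpTo',
          Nat.mem_primeFactors]
        by_cases h5 : p ∣ m
        · exact Or.inr (Or.inr ⟨hp'.1, h5, hm0⟩)
        · by_cases h6 : v < p
          · exact Or.inl ⟨⟨hp', h6⟩, h5⟩
          · exact Or.inr (Or.inl ⟨hp'.1, not_lt.1 h6⟩)
      have un : ∀ s t : Finset ℕ, ∑ p ∈ s ∪ t, f p * Real.log p ≤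
          ∑ p ∈ s, f p * Real.log p + ∑ p ∈ t, f p * Real.log p := by
        intro s t
        rw [← Finset.sum_union_inter]
        have : 0 ≤ ∑ p ∈ s ∩ t, f p * Real.log p := Finset.sum_nonneg fun p _ => hnn p
        linarith
      have e4 := un ((PP v (x / m)).filter (fun p => ¬ p ∣ m)) (primesUpTo v ∪ m.primeFactors)
      have e5 := un (primesUpTo v) m.primeFactors
      linarith
    rw [← Finset.mul_sum, ← Finset.mul_sum] at hsub
    have h3 := sum_log_le_two_mul hv
    have h4 := sum_log_primeFactors_le hm0
    have h5 : Real.log m ≤ Real.log x := Real.log_le_log (by linarith) (hmz.trans hzx)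
    have h6 : H * (∑ p ∈ primesUpTo v, Real.log p) + H * (∑ p ∈ m.primeFactors, Real.log p)
        ≤ H * (2 * v + Real.log x) := by
      rw [← mul_add]
      gcongr
      linarith
    have h7 : α / 2 * (x / z) ≤ α / 2 * (x / m) := by gcongr
    linarith
  calc α / 2 * x * ∑ m ∈ AA v z, f m / m = ∑ m ∈ AA v z, f m * (α / 2 * (x / m)) := by
        rw [Finset.mul_sum]
        exact Finset.sum_congr rfl fun m _ => by ring
    _ ≤ ∑ m ∈ AA v z, f m *
        ∑ p ∈ (PP v (x / m)).filter (fun p => ¬ p ∣ m), f p * Real.log p :=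
        Finset.sum_le_sum fun m hm => mul_le_mul_of_nonneg_left (inner m hm) (hf.nn m)
    _ = ∑ q ∈ (AA v z).sigma (fun m => (PP v (x / m)).filter (fun p => ¬ p ∣ m)),
          f q.1 * (f q.2 * Real.log q.2) := by
        rw [Finset.sum_sigma]
        exact Finset.sum_congr rfl fun m _ => by rw [Finset.mul_sum]
    _ ≤ ∑ q ∈ (AA v x).sigma (fun n => n.primeFactors), f q.1 * Real.log q.2 := by
        refine sum_le_sum_inj _ _ (fun q => (⟨q.1 * q.2, q.2⟩ : Sigma fun _ : ℕ => ℕ)) ?_ ?_ _ _ ?_ ?_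
        · rintro ⟨m, p⟩ hq
          simp only [Finset.mem_sigma, Finset.mem_filter, mem_AA, mem_PP] at hq
          obtain ⟨⟨⟨hm0, hmz⟩, hmp⟩, ⟨⟨hp, hpx⟩, hvp⟩, hpm⟩ := hq
          have hm1 : (0 : ℝ) < m := by exact_mod_cast Nat.pos_of_ne_zero hm0
          simp only [Finset.mem_sigma, mem_AA, Nat.mem_primeFactors]
          refine ⟨⟨⟨mul_ne_zero hm0 hp.ne_zero, ?_⟩, ?_⟩, hp, dvd_mul_left _ _,
            mul_ne_zero hm0 hp.ne_zero⟩
          · push_cast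
            rw [le_div_iff₀ hm1] at hpx
            linarith
          · intro r hr hrd
            rcases (Nat.Prime.dvd_mul hr).1 hrd with h | h
            · exact hmp r hr h
            · rw [(Nat.prime_dvd_prime_iff_eq hr hp).1 h]
              exact hvp
        · rintro ⟨m, p⟩ hq ⟨m', p'⟩ hq' heq
          simp only [Finset.coe_sigma, Set.mem_sigma_iff, Finset.mem_coe, Finset.mem_filter,
            mem_PP] at hq
          simp only [Sigma.mk.injEq, heq_eq_eq] at heq
          obtain ⟨h1, rfl⟩ := heq
          have := Nat.eq_of_mul_eq_mul_right hq.2.1.1.1.pos h1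
          rw [this]
        · rintro ⟨n, p⟩ _
          exact mul_nonneg (hf.nn n) (Real.log_natCast_nonneg p)
        · rintro ⟨m, p⟩ hq
          simp only [Finset.mem_sigma, Finset.mem_filter, mem_PP] at hq
          have : Nat.Coprime m p := ((Nat.Prime.coprime_iff_not_dvd hq.2.1.1.1).2 hq.2.2).symm
          simp only
          rw [hf.mul m p this, mul_assoc]
    _ = ∑ n ∈ AA v x, f n * ∑ p ∈ n.primeFactors, Real.log p := by
        rw [Finset.sum_sigma]
        exact Finset.sum_congr rfl fun m _ => by rw [Finset.mul_sum]
    _ ≤ ∑ n ∈ AA v x, f n * Real.log x := by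
        refine Finset.sum_le_sum fun n hn => mul_le_mul_of_nonneg_left ?_ (hf.nn n)
        obtain ⟨⟨hn0, hnx⟩, _⟩ := mem_AA.1 hn
        refine (sum_log_primeFactors_le hn0).trans (Real.log_le_log ?_ hnx)
        exact_mod_cast Nat.pos_of_ne_zero hn0
    _ = _ := by rw [← Finset.sum_mul, mul_comm]

lemma f_prod {f : ℕ → ℝ} {H : ℝ} (hf : NF f H) (T : Finset ℕ) (hT : ∀ p ∈ T, p.Prime) :
    f (∏ p ∈ T, p) = ∏ p ∈ T, f p := by
  induction T using Finset.induction_on with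
  | empty => simp [hf.one]
  | insert a s ha ih =>
    rw [Finset.prod_insert ha, Finset.prod_insert ha, hf.mul, ih]
    · intro p hp
      exact hT p (Finset.mem_insert_of_mem hp)
    · rw [Nat.coprime_prod_right_iff]
      intro p hp
      refine (Nat.coprime_primes (hT a (Finset.mem_insert_self _ _))
        (hT p (Finset.mem_insert_of_mem hp))).2 ?_
      rintro rfl
      exact ha hp

lemma lower2 {f : ℕ → ℝ} {H : ℝ} (hf : NF f H) {v y z : ℝ} (hz : 1 < z) (hy : 1 ≤ y)
    (hyz : 4 * H * Real.log y ≤ Real.log z) :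
    1 / 2 * ∏ p ∈ PP v y, (1 + f p / p) ≤ ∑ m ∈ AA v z, f m / m := by
  set E := ∏ p ∈ PP v y, (1 + f p / p) with hE
  have hH := hf.H1
  let F : Finset ℕ → ℝ := fun T => ∏ p ∈ T, f p / p
  let μ : Finset ℕ → ℕ := fun T => ∏ p ∈ T, p
  have hpp : ∀ p ∈ PP v y, p.Prime := fun p hp => (mem_PP.1 hp).1.1
  have hTp : ∀ T ∈ (PP v y).powerset, ∀ p ∈ T, p.Prime := fun T hT p hp =>
    hpp p (Finset.mem_powerset.1 hT hp)
  have hq0 : ∀ p : ℕ, 0 ≤ f p / p := fun p => div_nonneg (hf.nn p) (Nat.cast_nonneg p)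
  have hF0 : ∀ T, 0 ≤ F T := fun T => Finset.prod_nonneg fun p _ => hq0 p
  have hEs : E = ∑ T ∈ (PP v y).powerset, F T := by
    rw [hE, Finset.prod_one_add]
  have hlz : 0 < Real.log z := Real.log_pos hz
  -- log-weighted sum
  have hlog : ∑ T ∈ (PP v y).powerset, F T * Real.log (μ T) ≤ 1 / 2 * Real.log z * E := by
    calc ∑ T ∈ (PP v y).powerset, F T * Real.log (μ T)
        = ∑ T ∈ (PP v y).powerset, ∑ p ∈ T, F T * Real.log p := by
          refine Finset.sum_congr rfl fun T hT => ?_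
          simp only [μ]
          rw [Nat.cast_prod, Real.log_prod, Finset.mul_sum]
          intro p hp
          exact_mod_cast (hTp T hT p hp).ne_zero
      _ = ∑ p ∈ PP v y, ∑ T ∈ (PP v y).powerset.filter (fun T => p ∈ T), F T * Real.log p := by
          refine Finset.sum_comm' ?_
          intro T p
          simp only [Finset.mem_powerset, Finset.mem_filter]
          exact ⟨fun h => ⟨⟨h.1, h.2⟩, h.1 h.2⟩, fun h => ⟨h.1.1, h.1.2⟩⟩
      _ ≤ ∑ p ∈ PP v y, (H / p * E) * Real.log p := by
          refine Finset.sum_le_sum fun p hp => ?_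
          rw [← Finset.sum_mul]
          refine mul_le_mul_of_nonneg_right ?_ (Real.log_natCast_nonneg p)
          have : ∑ T ∈ (PP v y).powerset.filter (fun T => p ∈ T), F T ≤
              ∑ T ∈ (PP v y).powerset, f p / p * F T := by
            refine sum_le_sum_inj _ _ (fun T => T.erase p) ?_ ?_ _ _ ?_ ?_
            · intro T hT
              rw [Finset.mem_filter, Finset.mem_powerset] at hT
              exact Finset.mem_powerset.2 ((Finset.erase_subset _ _).trans hT.1)
            · intro T hT T' hT' heq
              rw [Finset.mem_coe, Finset.mem_filter] at hT hT'
              simp only at heq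
              rw [← Finset.insert_erase hT.2, heq, Finset.insert_erase hT'.2]
            · intro T _
              exact mul_nonneg (hq0 p) (hF0 T)
            · intro T hT
              rw [Finset.mem_filter] at hT
              exact (Finset.mul_prod_erase T (fun p : ℕ => f p / (p : ℝ)) hT.2).ge
          refine this.trans ?_
          rw [← Finset.mul_sum, ← hEs]
          have hE0 : 0 ≤ E := by
            rw [hEs]
            exact Finset.sum_nonneg fun T _ => hF0 T
          have := hf.p (hpp p hp)
          gcongr
      _ = (H * E) * ∑ p ∈ PP v y, Real.log p / p := by
          rw [Finset.mul_sum]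
          exact Finset.sum_congr rfl fun p _ => by ring
      _ ≤ (H * E) * (2 * Real.log y) := by
          have hE0 : 0 ≤ E := by
            rw [hEs]
            exact Finset.sum_nonneg fun T _ => hF0 T
          refine mul_le_mul_of_nonneg_left ?_ (by positivity)
          refine le_trans ?_ (sum_log_div_le hy)
          refine Finset.sum_le_sum_of_subset_of_nonneg (Finset.filter_subset _ _) ?_
          intro p _ _
          exact div_nonneg (Real.log_natCast_nonneg p) (Nat.cast_nonneg p)
      _ ≤ 1 / 2 * Real.log z * E := by
          have hE0 : 0 ≤ E := by
            rw [hEs]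
            exact Finset.sum_nonneg fun T _ => hF0 T
          nlinarith
  have htail : ∑ T ∈ (PP v y).powerset.filter (fun T => ¬ (μ T : ℝ) ≤ z), F T ≤ 1 / 2 * E := by
    have : Real.log z * ∑ T ∈ (PP v y).powerset.filter (fun T => ¬ (μ T : ℝ) ≤ z), F T ≤
        1 / 2 * Real.log z * E := by
      refine le_trans ?_ hlog
      rw [Finset.mul_sum]
      calc ∑ T ∈ (PP v y).powerset.filter (fun T => ¬ (μ T : ℝ) ≤ z), Real.log z * F T
          ≤ ∑ T ∈ (PP v y).powerset.filter (fun T => ¬ (μ T : ℝ) ≤ z),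
            F T * Real.log (μ T) := by
            refine Finset.sum_le_sum fun T hT => ?_
            rw [Finset.mem_filter] at hT
            rw [mul_comm]
            refine mul_le_mul_of_nonneg_left ?_ (hF0 T)
            exact Real.log_le_log (by linarith) (not_le.1 hT.2).le
        _ ≤ _ := by
            refine Finset.sum_le_sum_of_subset_of_nonneg (Finset.filter_subset _ _) ?_
            intro T _ _
            exact mul_nonneg (hF0 T) (Real.log_natCast_nonneg _)
    refine le_of_mul_le_mul_left ?_ hlz
    linarith
  have hsplit := Finset.sum_filter_add_sum_filter_not (PP v y).powerset
    (fun T => (μ T : ℝ) ≤ z) F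
  have hmain : ∑ T ∈ (PP v y).powerset.filter (fun T => (μ T : ℝ) ≤ z), F T ≤
      ∑ m ∈ AA v z, f m / m := by
    refine sum_le_sum_inj _ _ μ ?_ ?_ _ _ ?_ ?_
    · intro T hT
      rw [Finset.mem_filter] at hT
      refine mem_AA.2 ⟨⟨?_, hT.2⟩, ?_⟩
      · exact Finset.prod_ne_zero_iff.2 fun p hp => (hTp T hT.1 p hp).ne_zero
      · intro p hp hpd
        obtain ⟨q, hq, hpq⟩ := (Prime.dvd_finsetProd_iff hp.prime _).1 hpd
        rw [(Nat.prime_dvd_prime_iff_eq hp (hTp T hT.1 q hq)).1 hpq]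
        exact (mem_PP.1 (Finset.mem_powerset.1 hT.1 hq)).2
    · intro T hT T' hT' heq
      rw [Finset.mem_coe, Finset.mem_filter] at hT hT'
      have h1 := Nat.primeFactors_prod (hTp T hT.1)
      have h2 := Nat.primeFactors_prod (hTp T' hT'.1)
      rw [← h1, ← h2]
      exact congrArg Nat.primeFactors heq
    · intro m _
      exact hq0 m
    · intro T hT
      rw [Finset.mem_filter] at hT
      simp only [F, μ]
      rw [f_prod hf T (hTp T hT.1), Finset.prod_div_distrib, Nat.cast_prod]
  linarith

lemma lower3 {f : ℕ → ℝ} {H : ℝ} (hf : NF f H) {v x y : ℝ} (hy : 1 < y) (hyx : y ≤ x) :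
    ∏ p ∈ PP v x, (1 + f p / p) ≤
      Real.exp (2 * H * Real.log x / Real.log y) * ∏ p ∈ PP v y, (1 + f p / p) := by
  have hH := hf.H1
  have hly : 0 < Real.log y := Real.log_pos hy
  have hq0 : ∀ p : ℕ, 0 ≤ f p / p := fun p => div_nonneg (hf.nn p) (Nat.cast_nonneg p)
  have hsub : PP v y ⊆ PP v x := by
    intro p hp
    rw [mem_PP] at hp ⊢
    exact ⟨⟨hp.1.1, hp.1.2.trans hyx⟩, hp.2⟩
  rw [← Finset.prod_sdiff hsub]
  refine mul_le_mul_of_nonneg_right ?_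
    (Finset.prod_nonneg fun p _ => add_nonneg zero_le_one (hq0 p))
  refine (Real.prod_one_add_le_exp_sum _ hq0).trans (Real.exp_le_exp.2 ?_)
  have h1 : ∑ p ∈ PP v x \ PP v y, f p / p ≤
      ∑ p ∈ PP v x \ PP v y, H / Real.log y * (Real.log p / p) := by
    refine Finset.sum_le_sum fun p hp => ?_
    rw [Finset.mem_sdiff, mem_PP, mem_PP] at hp
    have hpy : y < p := by
      by_contra hc
      exact hp.2 ⟨⟨hp.1.1.1, not_lt.1 hc⟩, hp.1.2⟩
    have hl : Real.log y ≤ Real.log p := Real.log_le_log (by linarith) hpy.le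
    have hfp := hf.p hp.1.1.1
    have hp0 : (0 : ℝ) < p := by linarith
    have : f p ≤ H / Real.log y * Real.log p := by
      rw [div_mul_eq_mul_div, le_div_iff₀ hly]
      have := hf.nn p
      nlinarith
    calc f p / p ≤ (H / Real.log y * Real.log p) / p := by gcongr
      _ = _ := by ring
  refine h1.trans ?_
  rw [← Finset.mul_sum]
  have h2 : ∑ p ∈ PP v x \ PP v y, Real.log p / p ≤ 2 * Real.log x := by
    refine le_trans ?_ (sum_log_div_le (hy.le.trans hyx))
    refine Finset.sum_le_sum_of_subset_of_nonneg
      (Finset.sdiff_subset.trans (Finset.filter_subset _ _)) ?_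
    intro p _ _
    exact div_nonneg (Real.log_natCast_nonneg p) (Nat.cast_nonneg p)
  calc H / Real.log y * ∑ p ∈ PP v x \ PP v y, Real.log p / p
      ≤ H / Real.log y * (2 * Real.log x) := by gcongr
    _ = _ := by ring

lemma summable_log_div_sq : Summable (fun n : ℕ => Real.log n / (n : ℝ) ^ 2) := by
  have h : Summable (fun n : ℕ => 2 * (1 / (n : ℝ) ^ (3 / 2 : ℝ))) :=
    (Real.summable_one_div_nat_rpow.2 (by norm_num)).mul_left 2
  refine Summable.of_nonneg_of_le
    (fun n => div_nonneg (Real.log_natCast_nonneg n) (by positivity)) (fun n => ?_) h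
  rcases Nat.eq_zero_or_pos n with rfl | hn
  · simp
  have hn0 : (0 : ℝ) < n := by exact_mod_cast hn
  have h1 := Real.log_le_rpow_div (x := (n : ℝ)) (ε := 1 / 2) hn0.le (by norm_num)
  have h2 : (n : ℝ) ^ 2 = (n : ℝ) ^ (1 / 2 : ℝ) * (n : ℝ) ^ (3 / 2 : ℝ) := by
    rw [← Real.rpow_add hn0]
    norm_num
  have h3 : (0 : ℝ) < (n : ℝ) ^ (1 / 2 : ℝ) := Real.rpow_pos_of_pos hn0 _
  have h4 : (0 : ℝ) < (n : ℝ) ^ (3 / 2 : ℝ) := Real.rpow_pos_of_pos hn0 _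
  rw [h2, div_le_iff₀ (by positivity)]
  have : 2 * (1 / (n : ℝ) ^ (3 / 2 : ℝ)) * ((n : ℝ) ^ (1 / 2 : ℝ) * (n : ℝ) ^ (3 / 2 : ℝ))
      = (n : ℝ) ^ (1 / 2 : ℝ) / (1 / 2) := by
    field_simp
  rw [this]
  exact h1

lemma summable_half : Summable (fun k : ℕ => (k : ℝ) * (1 / 2 : ℝ) ^ k) := by
  have := summable_pow_mul_geometric_of_norm_lt_one (R := ℝ) 1 (r := 1 / 2) (by norm_num)
  simpa using this

/-- The constant in the prime power sum bound. -/
def KC (H : ℝ) : ℝ :=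
  2 * H + 4 * H ^ 2 * (∑' k : ℕ, (k : ℝ) * (1 / 2 : ℝ) ^ k) *
    ∑' n : ℕ, Real.log n / (n : ℝ) ^ 2

lemma inner_bound {f : ℕ → ℝ} {H : ℝ} (hf : NF f H) {v x y : ℝ} (hv : 2 * H ≤ v) (hy : 0 ≤ y)
    (N : ℕ) :
    ∑ q ∈ (PP v x ×ˢ Finset.Icc 1 N).filter (fun q => ((q.1 ^ q.2 : ℕ) : ℝ) ≤ y),
      f (q.1 ^ q.2) * (q.2 * Real.log q.1) ≤ KC H * y := by
  have hH := hf.H1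
  set K := ∑' k : ℕ, (k : ℝ) * (1 / 2 : ℝ) ^ k with hK
  set L := ∑' n : ℕ, Real.log n / (n : ℝ) ^ 2 with hL
  have hK0 : 0 ≤ K := tsum_nonneg fun k => by positivity
  calc ∑ q ∈ (PP v x ×ˢ Finset.Icc 1 N).filter (fun q => ((q.1 ^ q.2 : ℕ) : ℝ) ≤ y),
      f (q.1 ^ q.2) * (q.2 * Real.log q.1)
      ≤ ∑ q ∈ PP v x ×ˢ Finset.Icc 1 N,
        ((if q.2 = 1 ∧ (q.1 : ℝ) ≤ y then H * Real.log q.1 else 0) +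
          y * 4 * H ^ 2 * (Real.log q.1 / (q.1 : ℝ) ^ 2) * (q.2 * (1 / 2 : ℝ) ^ q.2)) := by
        rw [Finset.sum_filter]
        refine Finset.sum_le_sum ?_
        rintro ⟨p, k⟩ hq
        simp only [Finset.mem_product, mem_PP, Finset.mem_Icc] at hq
        obtain ⟨⟨⟨hp, hpx⟩, hvp⟩, hk1, hkN⟩ := hq
        simp only
        have hl := Real.log_natCast_nonneg p
        have hp0 : (0 : ℝ) < p := by exact_mod_cast hp.pos
        have hnn : 0 ≤ y * 4 * H ^ 2 * (Real.log p / (p : ℝ) ^ 2) * (k * (1 / 2 : ℝ) ^ k) := by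
          positivity
        have hnn2 : 0 ≤ (if k = 1 ∧ (p : ℝ) ≤ y then H * Real.log p else 0) := by
          split_ifs <;> positivity
        split_ifs with h1 h2 h2
        · obtain ⟨rfl, h3⟩ := h2
          have := hf.p hp
          have : f p * Real.log p ≤ H * Real.log p := by gcongr
          simp only [pow_one, Nat.cast_one, one_mul] at hnn ⊢
          linarith
        · have hk2 : 2 ≤ k := by
            rcases Nat.lt_or_ge k 2 with h | h
            · exfalso
              have : k = 1 := by omega
              subst this
              exact h2 ⟨rfl, by simpa using h1⟩
            · exact h
          obtain ⟨j, rfl⟩ : ∃ j, k = j + 2 := ⟨k - 2, by omega⟩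
          rw [zero_add]
          have hfk := hf.pk p (j + 2) hp hk1
          push_cast at h1
          have hr : H / p ≤ 1 / 2 := by
            rw [div_le_iff₀ hp0]
            linarith
          have hr0 : 0 ≤ H / p := by positivity
          have h5 : (H / p) ^ j ≤ (1 / 2 : ℝ) ^ j := pow_le_pow_left₀ hr0 hr j
          have h6 : H ^ (j + 2) ≤ y * (H / p) ^ (j + 2) := by
            rw [div_pow, mul_div_assoc', le_div_iff₀ (by positivity), mul_comm]
            gcongr
          calc f (p ^ (j + 2)) * (((j + 2 : ℕ) : ℝ) * Real.log p)
              ≤ (y * (H / p) ^ (j + 2)) * (((j + 2 : ℕ) : ℝ) * Real.log p) := by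
                gcongr
                exact hfk.trans h6
            _ = (y * (H / p) ^ 2) * (((j + 2 : ℕ) : ℝ) * Real.log p) * (H / p) ^ j := by ring
            _ ≤ (y * (H / p) ^ 2) * (((j + 2 : ℕ) : ℝ) * Real.log p) * (1 / 2 : ℝ) ^ j := by
                gcongr
            _ = _ := by
                rw [pow_add (1 / 2 : ℝ), div_pow]
                ring
        · have : 0 ≤ H * Real.log p := by positivity
          linarith
        · linarith
    _ = ∑ p ∈ PP v x, ∑ k ∈ Finset.Icc 1 N,
        ((if k = 1 ∧ (p : ℝ) ≤ y then H * Real.log p else 0) +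
          y * 4 * H ^ 2 * (Real.log p / (p : ℝ) ^ 2) * (k * (1 / 2 : ℝ) ^ k)) := by
        rw [Finset.sum_product]
    _ ≤ ∑ p ∈ PP v x, ((if (p : ℝ) ≤ y then H * Real.log p else 0) +
          y * 4 * H ^ 2 * K * (Real.log p / (p : ℝ) ^ 2)) := by
        refine Finset.sum_le_sum fun p hp => ?_
        have hl := Real.log_natCast_nonneg p
        rw [Finset.sum_add_distrib]
        refine add_le_add ?_ ?_
        · calc ∑ k ∈ Finset.Icc 1 N, (if k = 1 ∧ (p : ℝ) ≤ y then H * Real.log p else 0)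
              = ∑ k ∈ Finset.Icc 1 N, (if k = 1 then
                (if (p : ℝ) ≤ y then H * Real.log p else 0) else 0) := by
                refine Finset.sum_congr rfl fun k _ => ?_
                split_ifs <;> simp_all
            _ ≤ _ := by
                rw [Finset.sum_ite_eq']
                split_ifs <;> first | exact le_rfl | positivity
        · rw [← Finset.mul_sum]
          have : ∑ k ∈ Finset.Icc 1 N, (k : ℝ) * (1 / 2 : ℝ) ^ k ≤ K :=
            summable_half.sum_le_tsum _ fun k _ => by positivity
          calc _ ≤ y * 4 * H ^ 2 * (Real.log p / (p : ℝ) ^ 2) * K := by gcongr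
            _ = _ := by ring
    _ ≤ H * (2 * y) + y * 4 * H ^ 2 * K * L := by
        rw [Finset.sum_add_distrib]
        refine add_le_add ?_ ?_
        · rw [← Finset.sum_filter, ← Finset.mul_sum]
          refine mul_le_mul_of_nonneg_left ?_ (by linarith)
          refine le_trans ?_ (sum_log_le_two_mul hy)
          refine Finset.sum_le_sum_of_subset_of_nonneg ?_ fun p _ _ => Real.log_natCast_nonneg p
          intro p hp
          rw [Finset.mem_filter, mem_PP] at hp
          exact mem_primesUpTo'.2 ⟨hp.1.1.1, hp.2⟩
        · rw [← Finset.mul_sum]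
          refine mul_le_mul_of_nonneg_left ?_ (by positivity)
          exact summable_log_div_sq.sum_le_tsum _ fun n _ =>
            div_nonneg (Real.log_natCast_nonneg n) (by positivity)
    _ = KC H * y := by
        unfold KC
        ring

lemma upper1 {f : ℕ → ℝ} {H : ℝ} (hf : NF f H) {v x : ℝ} (hv : 2 * H ≤ v) (hx : 1 ≤ x) :
    Real.log x * ∑ n ∈ AA v x, f n ≤ (KC H + 1) * x * ∑ m ∈ AA v x, f m / m := by
  have hH := hf.H1
  have hlog : ∑ n ∈ AA v x, f n * Real.log n ≤ KC H * x * ∑ m ∈ AA v x, f m / m := by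
    calc ∑ n ∈ AA v x, f n * Real.log n
        = ∑ q ∈ (AA v x).sigma (fun n => n.primeFactors),
            f q.1 * ((q.1.factorization q.2 : ℝ) * Real.log q.2) := by
          rw [Finset.sum_sigma]
          refine Finset.sum_congr rfl fun n hn => ?_
          rw [log_eq_sum_factorization (mem_AA.1 hn).1.1, Finset.mul_sum]
      _ ≤ ∑ q ∈ (AA v x).sigma (fun m => (PP v x ×ˢ Finset.Icc 1 ⌊x⌋₊).filter
            (fun q => ((q.1 ^ q.2 : ℕ) : ℝ) ≤ x / m)),
            f q.1 * (f (q.2.1 ^ q.2.2) * (q.2.2 * Real.log q.2.1)) := by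
          refine sum_le_sum_inj _ _ (fun q => (⟨q.1 / q.2 ^ q.1.factorization q.2,
            (q.2, q.1.factorization q.2)⟩ : Sigma fun _ : ℕ => ℕ × ℕ)) ?_ ?_ _ _ ?_ ?_
          · rintro ⟨n, p⟩ hq
            simp only [Finset.mem_sigma, mem_AA, Nat.mem_primeFactors] at hq
            obtain ⟨⟨⟨hn0, hnx⟩, hnp⟩, hp, hpn, _⟩ := hq
            have hpos : n / p ^ n.factorization p ≠ 0 := (Nat.ordCompl_pos p hn0).ne'
            have hdvd : n / p ^ n.factorization p ∣ n := Nat.ordCompl_dvd n p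
            have hmul := Nat.ordProj_mul_ordCompl_eq_self n p
            have hnx' : n ≤ ⌊x⌋₊ := Nat.le_floor hnx
            have hm0 : (0 : ℝ) < ((n / p ^ n.factorization p : ℕ) : ℝ) := by
              exact_mod_cast Nat.pos_of_ne_zero hpos
            simp only [Finset.mem_sigma, mem_AA, Finset.mem_filter, Finset.mem_product, mem_PP,
              Finset.mem_Icc]
            refine ⟨⟨⟨hpos, ?_⟩, fun r hr hrd => hnp r hr (hrd.trans hdvd)⟩,
              ⟨⟨⟨hp, ?_⟩, hnp p hp hpn⟩, ?_, ?_⟩, ?_⟩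
            · refine le_trans ?_ hnx
              exact_mod_cast Nat.le_of_dvd (Nat.pos_of_ne_zero hn0) hdvd
            · refine le_trans ?_ hnx
              exact_mod_cast Nat.le_of_dvd (Nat.pos_of_ne_zero hn0) hpn
            · exact (hp.factorization_pos_of_dvd hn0 hpn)
            · exact (Nat.factorization_lt p hn0).le.trans hnx'
            · rw [le_div_iff₀ hm0]
              refine le_trans (le_of_eq ?_) hnx
              exact_mod_cast hmul
          · rintro ⟨n, p⟩ hq ⟨n', p'⟩ hq' heq
            simp only [Sigma.mk.injEq, heq_eq_eq, Prod.mk.injEq] at heq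
            obtain ⟨h1, rfl, h2⟩ := heq
            have e1 := Nat.ordProj_mul_ordCompl_eq_self n p
            have e2 := Nat.ordProj_mul_ordCompl_eq_self n' p
            have : n = n' := by rw [← e1, ← e2, h1, h2]
            rw [this]
          · rintro ⟨m, p, k⟩ _
            have := hf.nn m
            have := hf.nn (p ^ k)
            have := Real.log_natCast_nonneg p
            simp only
            positivity
          · rintro ⟨n, p⟩ hq
            simp only [Finset.mem_sigma, mem_AA, Nat.mem_primeFactors] at hq
            obtain ⟨⟨⟨hn0, hnx⟩, hnp⟩, hp, hpn, _⟩ := hq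
            have hco : Nat.Coprime (p ^ n.factorization p) (n / p ^ n.factorization p) :=
              Nat.Coprime.pow_left _ (Nat.coprime_ordCompl hp hn0)
            have hmul := Nat.ordProj_mul_ordCompl_eq_self n p
            have : f n = f (p ^ n.factorization p) * f (n / p ^ n.factorization p) := by
              rw [← hf.mul _ _ hco, hmul]
            simp only
            rw [this]
            exact le_of_eq (by ring)
      _ = ∑ m ∈ AA v x, f m * ∑ q ∈ (PP v x ×ˢ Finset.Icc 1 ⌊x⌋₊).filter
            (fun q => ((q.1 ^ q.2 : ℕ) : ℝ) ≤ x / m),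
            f (q.1 ^ q.2) * (q.2 * Real.log q.1) := by
          rw [Finset.sum_sigma]
          exact Finset.sum_congr rfl fun m _ => by rw [Finset.mul_sum]
      _ ≤ ∑ m ∈ AA v x, f m * (KC H * (x / m)) :=
          Finset.sum_le_sum fun m _ => mul_le_mul_of_nonneg_left
            (inner_bound hf hv (by positivity) _) (hf.nn m)
      _ = _ := by
          rw [Finset.mul_sum]
          exact Finset.sum_congr rfl fun m _ => by ring
  calc Real.log x * ∑ n ∈ AA v x, f n
      ≤ ∑ n ∈ AA v x, (f n * Real.log n + x * (f n / n)) := by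
        rw [Finset.mul_sum]
        refine Finset.sum_le_sum fun n hn => ?_
        have hn0 : (0 : ℝ) < n := by
          exact_mod_cast Nat.pos_of_ne_zero (mem_AA.1 hn).1.1
        have h1 : Real.log (x / n) ≤ x / n := Real.log_le_self (by positivity)
        rw [Real.log_div (by linarith) hn0.ne'] at h1
        have := hf.nn n
        calc Real.log x * f n ≤ (Real.log n + x / n) * f n := by
              gcongr
              linarith
          _ = _ := by ring
    _ ≤ _ := by
        rw [Finset.sum_add_distrib, ← Finset.mul_sum]
        linarith

lemma upper2 {f : ℕ → ℝ} {H : ℝ} (hf : NF f H) {v x : ℝ} (hv : 2 * H ≤ v) :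
    ∑ m ∈ AA v x, f m / m ≤ Real.exp (2 * H ^ 2 * ∑' n : ℕ, 1 / (n : ℝ) ^ 2) *
      ∏ p ∈ PP v x, (1 + f p / p) := by
  have hH := hf.H1
  let g : ℕ → ℝ := fun n => if n ≠ 0 ∧ ∀ p : ℕ, p.Prime → p ∣ n → v < p then f n / n else 0
  have g0 : ∀ n, 0 ≤ g n := by
    intro n
    simp only [g]
    have := hf.nn n
    split_ifs <;> positivity
  have g1 : g 1 = 1 := by
    simp only [g]
    rw [if_pos]
    · simp [hf.one]
    · refine ⟨one_ne_zero, fun p hp h => ?_⟩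
      exact absurd (Nat.dvd_one.1 h) hp.one_lt.ne'
  have gmul : ∀ {m n : ℕ}, Nat.Coprime m n → g (m * n) = g m * g n := by
    intro m n hmn
    simp only [g]
    have hiff : (m * n ≠ 0 ∧ ∀ p : ℕ, p.Prime → p ∣ m * n → v < p) ↔
        (m ≠ 0 ∧ ∀ p : ℕ, p.Prime → p ∣ m → v < p) ∧
        (n ≠ 0 ∧ ∀ p : ℕ, p.Prime → p ∣ n → v < p) := by
      constructor
      · rintro ⟨h1, h2⟩
        exact ⟨⟨left_ne_zero_of_mul h1, fun p hp h => h2 p hp (h.mul_right n)⟩,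
          right_ne_zero_of_mul h1, fun p hp h => h2 p hp (h.mul_left m)⟩
      · rintro ⟨⟨h1, h2⟩, h3, h4⟩
        refine ⟨mul_ne_zero h1 h3, fun p hp h => ?_⟩
        rcases (Nat.Prime.dvd_mul hp).1 h with h | h
        · exact h2 p hp h
        · exact h4 p hp h
    by_cases hm : (m ≠ 0 ∧ ∀ p : ℕ, p.Prime → p ∣ m → v < p)
    · by_cases hn : (n ≠ 0 ∧ ∀ p : ℕ, p.Prime → p ∣ n → v < p)
      · rw [if_pos (hiff.2 ⟨hm, hn⟩), if_pos hm, if_pos hn, hf.mul _ _ hmn]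
        push_cast
        rw [div_mul_div_comm]
      · rw [if_neg (fun h => hn (hiff.1 h).2), if_neg hn, mul_zero]
    · rw [if_neg (fun h => hm (hiff.1 h).1), if_neg hm, zero_mul]
  have gsmall : ∀ p : ℕ, p.Prime → ¬ v < p → ∀ k, g (p ^ (k + 1)) = 0 := by
    intro p hp hvp k
    simp only [g]
    rw [if_neg]
    rintro ⟨_, h⟩
    exact hvp (h p hp (dvd_pow_self p (by omega)))
  have gbig : ∀ p : ℕ, p.Prime → v < p → ∀ k, g (p ^ k) = f (p ^ k) / (p : ℝ) ^ k := by
    intro p hp hvp k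
    simp only [g]
    rw [if_pos]
    · push_cast
      rfl
    · refine ⟨pow_ne_zero _ hp.ne_zero, fun q hq hd => ?_⟩
      rw [(Nat.prime_dvd_prime_iff_eq hq hp).1 (hq.dvd_of_dvd_pow hd)]
      exact hvp
  have gk : ∀ p : ℕ, p.Prime → v < p → ∀ k, 1 ≤ k → g (p ^ k) ≤ (H / p) ^ k := by
    intro p hp hvp k hk
    rw [gbig p hp hvp, div_pow]
    have := hf.pk p k hp hk
    gcongr
  have hr : ∀ p : ℕ, p.Prime → v < p → H / p ≤ 1 / 2 := by
    intro p hp hvp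
    have hp0 : (0 : ℝ) < p := by exact_mod_cast hp.pos
    rw [div_le_iff₀ hp0]
    linarith
  have ghalf : ∀ p : ℕ, p.Prime → ∀ k, g (p ^ k) ≤ (1 / 2 : ℝ) ^ k := by
    intro p hp k
    rcases k with _ | k
    · simp [g1]
    · by_cases hvp : v < p
      · refine (gk p hp hvp (k + 1) (by omega)).trans ?_
        exact pow_le_pow_left₀ (by positivity) (hr p hp hvp) _
      · rw [gsmall p hp hvp]
        positivity
  have gsum : ∀ p : ℕ, p.Prime → Summable (fun k : ℕ => g (p ^ k)) := by
    intro p hp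
    refine Summable.of_nonneg_of_le (fun k => g0 _) (ghalf p hp) ?_
    exact summable_geometric_of_lt_one (by norm_num) (by norm_num)
  have tsmall : ∀ p : ℕ, p.Prime → ¬ v < p → ∑' k : ℕ, g (p ^ k) = 1 := by
    intro p hp hvp
    rw [tsum_eq_single 0]
    · simp [g1]
    · intro k hk
      obtain ⟨j, rfl⟩ := Nat.exists_eq_succ_of_ne_zero hk
      exact gsmall p hp hvp j
  have tbig : ∀ p : ℕ, p.Prime → v < p →
      ∑' k : ℕ, g (p ^ k) ≤ (1 + f p / p) * (1 + 2 * H ^ 2 * (1 / (p : ℝ) ^ 2)) := by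
    intro p hp hvp
    have hp0 : (0 : ℝ) < p := by exact_mod_cast hp.pos
    rw [← (gsum p hp).sum_add_tsum_nat_add 2]
    have e1 : ∑ k ∈ Finset.range 2, g (p ^ k) = 1 + f p / p := by
      rw [Finset.sum_range_succ, Finset.sum_range_one, pow_zero, g1, gbig p hp hvp]
      simp
    have e2 : ∑' k : ℕ, g (p ^ (k + 2)) ≤ 2 * H ^ 2 * (1 / (p : ℝ) ^ 2) := by
      have hs : HasSum (fun k : ℕ => (H / p) ^ 2 * (1 / 2 : ℝ) ^ k) ((H / p) ^ 2 * 2) := by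
        have := hasSum_geometric_two.mul_left ((H / p) ^ 2)
        exact this
      have : ∑' k : ℕ, g (p ^ (k + 2)) ≤ (H / p) ^ 2 * 2 := by
        have hs2 : Summable (fun k : ℕ => g (p ^ (k + 2))) :=
          (summable_nat_add_iff (f := fun k : ℕ => g (p ^ k)) 2).2 (gsum p hp)
        refine hasSum_le (fun k => ?_) hs2.hasSum hs
        refine (gk p hp hvp (k + 2) (by omega)).trans ?_
        rw [pow_add, mul_comm]
        refine mul_le_mul_of_nonneg_left ?_ (by positivity)
        exact pow_le_pow_left₀ (by positivity) (hr p hp hvp) _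
      refine this.trans (le_of_eq ?_)
      rw [div_pow]
      ring
    rw [e1]
    have := hf.nn p
    have h3 : 0 ≤ f p / p * (2 * H ^ 2 * (1 / (p : ℝ) ^ 2)) := by positivity
    nlinarith
  have hsum := (EulerProduct.summable_and_hasSum_smoothNumbers_prod_primesBelow_tsum g1 gmul
    (fun {p} hp => by simpa only [Real.norm_of_nonneg (g0 _)] using gsum p hp) (⌊x⌋₊ + 1)).2
  have hle : ∑ m ∈ AA v x, f m / m ≤
      ∏ p ∈ (⌊x⌋₊ + 1).primesBelow, ∑' k : ℕ, g (p ^ k) := by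
    rw [show (fun m : (⌊x⌋₊ + 1).smoothNumbers => g m) = g ∘ Subtype.val from rfl,
      hasSum_subtype_iff_indicator] at hsum
    refine le_trans (le_of_eq ?_) (sum_le_hasSum (AA v x) ?_ hsum)
    · refine Finset.sum_congr rfl fun m hm => ?_
      obtain ⟨⟨hm0, hmx⟩, hmp⟩ := mem_AA.1 hm
      rw [Set.indicator_of_mem]
      · simp only [g]
        rw [if_pos ⟨hm0, hmp⟩]
      · exact Nat.mem_smoothNumbers_of_lt (Nat.pos_of_ne_zero hm0)
          (Nat.lt_succ_of_le (Nat.le_floor hmx))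
    · intro m _
      exact Set.indicator_nonneg (fun m _ => g0 m) m
  refine hle.trans ?_
  have hsub : PP v x ⊆ (⌊x⌋₊ + 1).primesBelow := by
    intro p hp
    obtain ⟨⟨hp, hpx⟩, _⟩ := mem_PP.1 hp
    exact Nat.mem_primesBelow.2 ⟨Nat.lt_succ_of_le (Nat.le_floor hpx), hp⟩
  rw [← Finset.prod_subset hsub]
  · calc ∏ p ∈ PP v x, ∑' k : ℕ, g (p ^ k)
        ≤ ∏ p ∈ PP v x, ((1 + f p / p) * (1 + 2 * H ^ 2 * (1 / (p : ℝ) ^ 2))) := by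
          refine Finset.prod_le_prod (fun p _ => tsum_nonneg fun k => g0 _) fun p hp => ?_
          exact tbig p (mem_PP.1 hp).1.1 (mem_PP.1 hp).2
      _ = (∏ p ∈ PP v x, (1 + 2 * H ^ 2 * (1 / (p : ℝ) ^ 2))) *
            ∏ p ∈ PP v x, (1 + f p / p) := by
          rw [Finset.prod_mul_distrib, mul_comm]
      _ ≤ _ := by
          refine mul_le_mul_of_nonneg_right ?_ (Finset.prod_nonneg fun p _ => by
            have := hf.nn p
            positivity)
          refine (Real.prod_one_add_le_exp_sum _ fun p => by positivity).trans
            (Real.exp_le_exp.2 ?_)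
          rw [← Finset.mul_sum]
          refine mul_le_mul_of_nonneg_left ?_ (by positivity)
          exact (Real.summable_one_div_nat_pow.2 (by norm_num)).sum_le_tsum _
            fun n _ => by positivity
  · intro p hp hpn
    have hp' := Nat.mem_primesBelow.1 hp
    refine tsmall p hp'.2 fun hvp => hpn (mem_PP.2 ⟨⟨hp'.2, ?_⟩, hvp⟩)
    exact (Nat.le_floor_iff' hp'.2.ne_zero).1 (Nat.lt_succ_iff.1 hp'.1)

lemma abel_ge (d b : ℕ → ℝ) (C : ℝ) (hb : ∀ n, b (n + 1) ≤ b n)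
    (hd : ∀ n, -C ≤ ∑ i ∈ Finset.range n, d i) (N : ℕ) :
    (∑ i ∈ Finset.range (N + 1), d i + C) * b N - C * b 0 ≤
      ∑ i ∈ Finset.range (N + 1), d i * b i := by
  induction N with
  | zero =>
    simp
    linarith
  | succ N ih =>
    rw [Finset.sum_range_succ _ (N + 1), Finset.sum_range_succ (fun i => d i * b i) (N + 1)]
    have h1 := hd (N + 1)
    have h2 := hb N
    nlinarith

lemma sum_inv_mul_log_ge (M : ℕ) :
    Real.log (Real.log ((M : ℝ) + 2)) - Real.log (Real.log 2) ≤
      ∑ i ∈ Finset.range M, 1 / (((i : ℝ) + 2) * Real.log ((i : ℝ) + 2)) := by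
  induction M with
  | zero => simp
  | succ M ih =>
    rw [Finset.sum_range_succ]
    have hM : (0 : ℝ) ≤ M := Nat.cast_nonneg M
    have hl : 0 < Real.log ((M : ℝ) + 2) := Real.log_pos (by linarith)
    have hl3 : 0 < Real.log ((M : ℝ) + 1 + 2) := Real.log_pos (by linarith)
    have h1 : Real.log (Real.log ((M : ℝ) + 1 + 2)) - Real.log (Real.log ((M : ℝ) + 2)) ≤
        1 / (((M : ℝ) + 2) * Real.log ((M : ℝ) + 2)) := by
      rw [← Real.log_div hl3.ne' hl.ne']
      refine (Real.log_le_sub_one_of_pos (by positivity)).trans ?_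
      rw [div_sub_one hl.ne', div_le_div_iff₀ hl (by positivity)]
      have h2 : Real.log ((M : ℝ) + 1 + 2) - Real.log ((M : ℝ) + 2) ≤ 1 / ((M : ℝ) + 2) := by
        rw [← Real.log_div (by linarith) (by linarith)]
        refine (Real.log_le_sub_one_of_pos (by positivity)).trans (le_of_eq ?_)
        field_simp
        ring
      rw [le_div_iff₀ (by linarith)] at h2
      nlinarith
    push_cast
    linarith

lemma sum_div_ge {f : ℕ → ℝ} {H : ℝ} (hf : NF f H) {α x₀ : ℝ} (hα : 0 < α)
    (hc : ∀ y ≥ x₀, α ≤ (1 / y) * ∑ p ∈ primesUpTo y, f p * Real.log p) :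
    ∃ C : ℝ, ∀ x ≥ 2, α * Real.log (Real.log x) - C ≤ ∑ p ∈ primesUpTo x, f p / p := by
  let a : ℕ → ℝ := fun n => if n.Prime then f n * Real.log n else 0
  let b : ℕ → ℝ := fun i => 1 / (((i : ℝ) + 2) * Real.log ((i : ℝ) + 2))
  have a0 : ∀ n, 0 ≤ a n := by
    intro n
    simp only [a]
    have := hf.nn n
    have := Real.log_natCast_nonneg n
    split_ifs <;> positivity
  have hb : ∀ n, b (n + 1) ≤ b n := by
    intro n
    simp only [b]
    have hl : 0 < Real.log ((n : ℝ) + 2) := Real.log_pos (by linarith [n.cast_nonneg (α := ℝ)])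
    push_cast
    gcongr <;> linarith
  have b0 : ∀ n, 0 ≤ b n := by
    intro n
    simp only [b]
    have hl : 0 < Real.log ((n : ℝ) + 2) := Real.log_pos (by linarith [n.cast_nonneg (α := ℝ)])
    positivity
  have reindex : ∀ (F : ℕ → ℝ) (n : ℕ) (y : ℝ), ⌊y⌋₊ = n + 1 → ∑ p ∈ primesUpTo y, F p =
      ∑ i ∈ Finset.range n, (if (i + 2).Prime then F (i + 2) else 0) := by
    intro F n y hy
    unfold primesUpTo
    rw [hy, Finset.sum_filter, Finset.range_eq_Ico, Finset.sum_Ico_add' (fun i => if i.Prime then F i else 0) 0 n 2]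
    have : Finset.Icc 1 (n + 1) = insert 1 (Finset.Ico (0 + 2) (n + 2)) := by
      ext i
      simp only [Finset.mem_Icc, Finset.mem_insert, Finset.mem_Ico]
      omega
    rw [this, Finset.sum_insert (by simp)]
    simp [Nat.not_prime_one]
  set C := α * |x₀| with hC
  have hC0 : 0 ≤ C := by positivity
  have hd : ∀ n, -C ≤ ∑ i ∈ Finset.range n, (a (i + 2) - α) := by
    intro n
    rw [Finset.sum_sub_distrib, Finset.sum_const, Finset.card_range, nsmul_eq_mul]
    by_cases hn : x₀ ≤ (n : ℝ) + 1
    · have h1 := hc ((n : ℝ) + 1) hn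
      have hn0 : (0 : ℝ) < (n : ℝ) + 1 := by positivity
      rw [one_div_mul_eq_div, le_div_iff₀ hn0, reindex _ n _ (by
        have : (n : ℝ) + 1 = ((n + 1 : ℕ) : ℝ) := by push_cast; rfl
        rw [this, Nat.floor_natCast])] at h1
      have : ∑ i ∈ Finset.range n, a (i + 2) = ∑ i ∈ Finset.range n,
          (if (i + 2).Prime then f (i + 2) * Real.log ((i + 2 : ℕ) : ℝ) else 0) := rfl
      rw [this]
      nlinarith
    · have h1 : 0 ≤ ∑ i ∈ Finset.range n, a (i + 2) := Finset.sum_nonneg fun i _ => a0 _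
      have h2 : (n : ℝ) ≤ |x₀| := by
        have := le_abs_self x₀
        linarith
      nlinarith
  refine ⟨α * Real.log (Real.log 2) + C * b 0, fun x hx => ?_⟩
  have hfl : 2 ≤ ⌊x⌋₊ := Nat.le_floor (by simpa using hx)
  obtain ⟨M, hM⟩ : ∃ M, ⌊x⌋₊ = (M + 1) + 1 := ⟨⌊x⌋₊ - 2, by omega⟩
  rw [reindex _ (M + 1) x hM]
  have h1 := abel_ge (fun i => a (i + 2) - α) b C hb hd M
  have h2 : 0 ≤ (∑ i ∈ Finset.range (M + 1), (a (i + 2) - α) + C) * b M := by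
    refine mul_nonneg ?_ (b0 M)
    linarith [hd (M + 1)]
  have h3 : ∑ i ∈ Finset.range (M + 1), (a (i + 2) - α) * b i =
      ∑ i ∈ Finset.range (M + 1), (if (i + 2).Prime then f (i + 2) / ((i + 2 : ℕ) : ℝ) else 0) -
        α * ∑ i ∈ Finset.range (M + 1), b i := by
    rw [Finset.mul_sum, ← Finset.sum_sub_distrib]
    refine Finset.sum_congr rfl fun i _ => ?_
    rw [sub_mul]
    congr 1
    simp only [a, b]
    have hl : 0 < Real.log ((i : ℝ) + 2) := Real.log_pos (by linarith [i.cast_nonneg (α := ℝ)])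
    have hi : (0 : ℝ) < (i : ℝ) + 2 := by positivity
    split_ifs
    · push_cast
      field_simp
    · simp
  have h4 := sum_inv_mul_log_ge (M + 1)
  have h5 : Real.log (Real.log x) ≤ Real.log (Real.log (((M + 1 : ℕ) : ℝ) + 2)) := by
    have hlx : 0 < Real.log x := Real.log_pos (by linarith)
    refine Real.log_le_log hlx (Real.log_le_log (by linarith) ?_)
    have := Nat.lt_floor_add_one x
    rw [hM] at this
    push_cast at this ⊢
    linarith
  have h6 : α * (Real.log (Real.log x) - Real.log (Real.log 2)) ≤
      α * ∑ i ∈ Finset.range (M + 1), b i := by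
    refine mul_le_mul_of_nonneg_left ?_ hα.le
    linarith
  linarith

lemma sum_inv_le {v : ℝ} (hv : 1 ≤ v) : ∑ p ∈ primesUpTo v, 1 / (p : ℝ) ≤ 1 + Real.log v := by
  have h1 := harmonic_floor_le_one_add_log v hv
  rw [harmonic_eq_sum_Icc] at h1
  push_cast at h1
  refine le_trans ?_ h1
  unfold primesUpTo
  simp only [one_div]
  exact Finset.sum_le_sum_of_subset_of_nonneg (Finset.filter_subset _ _)
    fun p _ _ => by positivity

lemma prod_ge {f : ℕ → ℝ} {H : ℝ} (hf : NF f H) {v x : ℝ} (hv : 1 ≤ v) :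
    Real.exp (∑ p ∈ primesUpTo x, f p / p - H * (1 + Real.log v) -
      H ^ 2 * ∑' n : ℕ, 1 / (n : ℝ) ^ 2) ≤ ∏ p ∈ PP v x, (1 + f p / p) := by
  have hH := hf.H1
  have hq0 : ∀ p : ℕ, 0 ≤ f p / p := fun p => div_nonneg (hf.nn p) (Nat.cast_nonneg p)
  have h1 : Real.exp (∑ p ∈ PP v x, (f p / p - H ^ 2 * (1 / (p : ℝ) ^ 2))) ≤
      ∏ p ∈ PP v x, (1 + f p / p) := by
    rw [Real.exp_sum]
    refine Finset.prod_le_prod (fun p _ => (Real.exp_pos _).le) fun p hp => ?_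
    have hp' := (mem_PP.1 hp).1.1
    have hu := hq0 p
    rw [← Real.le_log_iff_exp_le (by linarith)]
    refine le_trans ?_ (Real.one_sub_inv_le_log_of_pos (by linarith))
    have h2 : (f p / p) ^ 2 ≤ H ^ 2 * (1 / (p : ℝ) ^ 2) := by
      rw [div_pow, mul_one_div]
      have := hf.p hp'
      have := hf.nn p
      gcongr
    have h3 : f p / p - (f p / p) ^ 2 ≤ 1 - (1 + f p / p)⁻¹ := by
      have : 1 - (1 + f p / p)⁻¹ = (f p / p) / (1 + f p / p) := by
        field_simp
        ring
      rw [this, le_div_iff₀ (by linarith)]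
      nlinarith [pow_nonneg hu 3]
    linarith
  refine le_trans (Real.exp_le_exp.2 ?_) h1
  rw [Finset.sum_sub_distrib, ← Finset.mul_sum]
  have h2 : ∑ p ∈ PP v x, 1 / (p : ℝ) ^ 2 ≤ ∑' n : ℕ, 1 / (n : ℝ) ^ 2 :=
    (Real.summable_one_div_nat_pow.2 (by norm_num)).sum_le_tsum _ fun n _ => by positivity
  have h3 : ∑ p ∈ primesUpTo x, f p / p ≤ ∑ p ∈ PP v x, f p / p + H * (1 + Real.log v) := by
    rw [← Finset.sum_filter_add_sum_filter_not (primesUpTo x) (fun p : ℕ => v < (p : ℝ))]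
    refine add_le_add le_rfl ?_
    refine le_trans ?_ (mul_le_mul_of_nonneg_left (sum_inv_le hv) (by linarith))
    rw [Finset.mul_sum]
    refine le_trans (Finset.sum_le_sum (g := fun p : ℕ => H * (1 / (p : ℝ))) fun p hp => ?_)
      (Finset.sum_le_sum_of_subset_of_nonneg ?_ fun p _ _ => by positivity)
    · rw [Finset.mem_filter, mem_primesUpTo'] at hp
      have := hf.p hp.1.1
      rw [mul_one_div]
      gcongr
    · intro p hp
      rw [Finset.mem_filter, mem_primesUpTo'] at hp
      exact mem_primesUpTo'.2 ⟨hp.1.1, not_lt.1 hp.2⟩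
  have h4 := mul_le_mul_of_nonneg_left h2 (sq_nonneg H)
  linarith

lemma w_large {w : ℝ → ℝ} (hw : GoodW w) (K : ℝ) (hK : 0 < K) :
    ∀ᶠ x in atTop, K ≤ w x ∧ w x ≤ Real.log (Real.log x) := by
  obtain ⟨x₀, hx₀⟩ := hw
  have hLL : Tendsto (fun x : ℝ => Real.log (Real.log x)) atTop atTop :=
    Real.tendsto_log_atTop.comp Real.tendsto_log_atTop
  have hLLL : Tendsto (fun x : ℝ => Real.log (Real.log (Real.log x))) atTop atTop :=
    Real.tendsto_log_atTop.comp hLL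
  have h1 := Real.isLittleO_log_id_atTop.def (c := 1 / K) (by positivity)
  have h2 := hLL.eventually h1
  filter_upwards [eventually_ge_atTop x₀, h2, hLL.eventually_gt_atTop 0,
    hLLL.eventually_gt_atTop 0] with x hx h3 h4 h5
  refine ⟨?_, (hx₀ x hx).2⟩
  refine le_trans ?_ (hx₀ x hx).1.le
  simp only [id, Real.norm_of_nonneg h4.le, Real.norm_of_nonneg h5.le] at h3
  rw [le_div_iff₀ h5]
  rw [one_div_mul_eq_div, le_div_iff₀ hK] at h3
  linarith

/-- Equation (1.7): if `h` is multiplicative and satisfies conditions (i)–(iii),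
then `∑_{n ≤ x, gcd(n, W(x)) = 1} |h(n)| ≍ (x/log x) ∏_{w(x) < p ≤ x} (1 + |h(p)|/p)`,
and this quantity is `≫_ε x (log x)^{α_h − ε − 1}` for every `ε > 0`. -/
theorem stmt_3 (w : ℝ → ℝ) (hw : GoodW w) (h : ℕ → ℝ) (hmult : MultFn h)
    (H : ℝ) (h1 : CondI h H) (h2 : CondII h) (α : ℝ) (h3 : CondIII h α) :
    (∃ c₁ : ℝ, 0 < c₁ ∧ ∃ c₂ : ℝ, 0 < c₂ ∧ ∃ x₀ : ℝ, ∀ x ≥ x₀,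
      c₁ * ((x / Real.log x) *
          ∏ p ∈ (primesUpTo x).filter (fun p : ℕ => w x < (p : ℝ)), (1 + |h p| / p))
        ≤ ∑ n ∈ (Finset.Icc 1 ⌊x⌋₊).filter (fun n => Nat.Coprime n (Wprod w x)), |h n| ∧
      (∑ n ∈ (Finset.Icc 1 ⌊x⌋₊).filter (fun n => Nat.Coprime n (Wprod w x)), |h n|)
        ≤ c₂ * ((x / Real.log x) *
          ∏ p ∈ (primesUpTo x).filter (fun p : ℕ => w x < (p : ℝ)), (1 + |h p| / p))) ∧
    (∀ ε : ℝ, 0 < ε → ∃ c₃ : ℝ, 0 < c₃ ∧ ∃ x₁ : ℝ, ∀ x ≥ x₁,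
      c₃ * (x * (Real.log x) ^ (α - ε - 1))
        ≤ ∑ n ∈ (Finset.Icc 1 ⌊x⌋₊).filter (fun n => Nat.Coprime n (Wprod w x)), |h n|) := by
  have hH := h1.1
  have hα := h3.1
  obtain ⟨x₀, hx₀⟩ := h3.2
  set f : ℕ → ℝ := fun n => |h n| with hfdef
  have hf : NF f H :=
    { nn := fun n => abs_nonneg _
      one := by simp [hfdef, hmult.1]
      mul := fun m n hmn => by simp only [hfdef]; rw [hmult.2 m n hmn, abs_mul]
      H1 := hH
      pk := h1.2 }
  have hAA : ∀ x : ℝ, (Finset.Icc 1 ⌊x⌋₊).filter (fun n => Nat.Coprime n (Wprod w x)) =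
      AA (w x) x := by
    intro x
    unfold AA
    exact Finset.filter_congr fun n _ => coprime_Wprod
  have hPP : ∀ x : ℝ, (primesUpTo x).filter (fun p : ℕ => w x < (p : ℝ)) = PP (w x) x :=
    fun x => rfl
  simp only [hAA, hPP]
  have hprod0 : ∀ v x : ℝ, 0 ≤ ∏ p ∈ PP v x, (1 + f p / p) := fun v x =>
    Finset.prod_nonneg fun p _ => by
      have := hf.nn p
      positivity
  -- eventual lower bound
  have hlow : ∀ᶠ x in atTop, α / 4 * Real.exp (-(16 * H ^ 2)) * ((x / Real.log x) *
      ∏ p ∈ PP (w x) x, (1 + f p / p)) ≤ ∑ n ∈ AA (w x) x, f n := by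
    have hsq : Tendsto (fun x : ℝ => Real.sqrt x) atTop atTop := Real.tendsto_sqrt_atTop
    have hlo := (isLittleO_log_rpow_atTop (r := 1 / 2) (by norm_num)).def
      (c := α / (6 * H)) (by positivity)
    filter_upwards [w_large hw (2 * H) (by linarith), eventually_gt_atTop (Real.exp 1),
      hsq.eventually_ge_atTop x₀, hlo] with x hwx hxe hsx hlx
    have hx1 : 1 < x := lt_trans (by simp) hxe
    have hx0 : 0 < x := by linarith
    have hL1 : 1 < Real.log x := (Real.lt_log_iff_exp_lt hx0).2 hxe
    have hs1 : 1 < Real.sqrt x := by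
      rw [Real.lt_sqrt (by norm_num)]
      simpa using hx1
    have hss : Real.sqrt x * Real.sqrt x = x := Real.mul_self_sqrt hx0.le
    have hsle : Real.sqrt x ≤ x := by nlinarith
    have hdiv : x / Real.sqrt x = Real.sqrt x := Real.div_sqrt
    have hlogs : Real.log (Real.sqrt x) = Real.log x / 2 := Real.log_sqrt hx0.le
    rw [Real.norm_of_nonneg (by linarith), Real.norm_of_nonneg (by positivity),
      ← Real.sqrt_eq_rpow] at hlx
    have hwl : w x ≤ Real.log x := hwx.2.trans (Real.log_le_self (by linarith))
    have l1 := lower1 hf (α := α) (v := w x) (x := x) (z := Real.sqrt x) hs1.le hsle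
      (by linarith [hwx.1]) (by
        rw [hdiv]
        intro y hy
        have hy0 : 0 < y := by linarith
        have := hx₀ y (hsx.trans hy)
        rw [one_div_mul_eq_div, le_div_iff₀ hy0] at this
        exact this) hα (by
        rw [hdiv]
        have : H * (2 * w x + Real.log x) ≤ H * (3 * Real.log x) := by
          gcongr
          linarith
        refine this.trans ?_
        have : H * (3 * Real.log x) ≤ H * (3 * (α / (6 * H) * Real.sqrt x)) := by gcongr
        refine this.trans (le_of_eq ?_)
        field_simp
        ring)
    set y := Real.exp (Real.log x / (8 * H)) with hy
    have hly : Real.log y = Real.log x / (8 * H) := Real.log_exp _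
    have hy1 : 1 < y := by
      rw [hy]
      exact Real.one_lt_exp_iff.2 (by positivity)
    have hyx : y ≤ x := by
      rw [← Real.log_le_log_iff (by linarith) hx0, hly]
      exact div_le_self (by linarith) (by linarith)
    have l2 := lower2 hf (v := w x) (y := y) (z := Real.sqrt x) hs1 hy1.le (by
      rw [hly, hlogs]
      exact le_of_eq (by field_simp; ring))
    have l3 := lower3 hf (v := w x) hy1 hyx
    have he : 2 * H * Real.log x / Real.log y = 16 * H ^ 2 := by
      rw [hly]
      have : Real.log x ≠ 0 := by linarith
      field_simp
      ring
    rw [he] at l3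
    set E := ∏ p ∈ PP (w x) x, (1 + f p / p)
    have l4 : Real.exp (-(16 * H ^ 2)) * E ≤ ∏ p ∈ PP (w x) y, (1 + f p / p) := by
      rw [Real.exp_neg, inv_mul_le_iff₀ (Real.exp_pos _)]
      exact l3
    have l5 : α / 2 * x * (1 / 2 * (Real.exp (-(16 * H ^ 2)) * E)) ≤
        Real.log x * ∑ n ∈ AA (w x) x, f n := by
      refine le_trans ?_ l1
      refine mul_le_mul_of_nonneg_left ?_ (by positivity)
      linarith
    rw [mul_comm (Real.log x), ← div_le_iff₀ (by linarith)] at l5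
    refine le_trans (le_of_eq ?_) l5
    ring
  have hup : ∀ᶠ x in atTop, ∑ n ∈ AA (w x) x, f n ≤
      ((KC H + 1) * Real.exp (2 * H ^ 2 * ∑' n : ℕ, 1 / (n : ℝ) ^ 2)) * ((x / Real.log x) *
      ∏ p ∈ PP (w x) x, (1 + f p / p)) := by
    filter_upwards [w_large hw (2 * H) (by linarith), eventually_gt_atTop 1] with x hwx hx1
    have hl : 0 < Real.log x := Real.log_pos hx1
    have u1 := upper1 hf hwx.1 hx1.le
    have u2 := upper2 hf (x := x) hwx.1
    have hK : 0 ≤ KC H + 1 := by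
      unfold KC
      have e1 : 0 ≤ ∑' k : ℕ, (k : ℝ) * (1 / 2 : ℝ) ^ k := tsum_nonneg fun k => by positivity
      have e2 : 0 ≤ ∑' n : ℕ, Real.log n / (n : ℝ) ^ 2 := tsum_nonneg fun n =>
        div_nonneg (Real.log_natCast_nonneg n) (by positivity)
      positivity
    have u3 := u1.trans (mul_le_mul_of_nonneg_left u2
      (mul_nonneg hK (by linarith : (0 : ℝ) ≤ x)))
    rw [mul_comm (Real.log x), ← le_div_iff₀ hl] at u3
    refine u3.trans (le_of_eq ?_)
    ring
  have hc1 : 0 < α / 4 * Real.exp (-(16 * H ^ 2)) := by positivity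
  refine ⟨⟨α / 4 * Real.exp (-(16 * H ^ 2)), hc1,
    (KC H + 1) * Real.exp (2 * H ^ 2 * ∑' n : ℕ, 1 / (n : ℝ) ^ 2), ?_, ?_⟩, ?_⟩
  · have : 0 < KC H + 1 := by
      unfold KC
      have e1 : 0 ≤ ∑' k : ℕ, (k : ℝ) * (1 / 2 : ℝ) ^ k := tsum_nonneg fun k => by positivity
      have e2 : 0 ≤ ∑' n : ℕ, Real.log n / (n : ℝ) ^ 2 := tsum_nonneg fun n =>
        div_nonneg (Real.log_natCast_nonneg n) (by positivity)
      positivity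
    positivity
  · obtain ⟨X, hX⟩ := eventually_atTop.1 (hlow.and hup)
    exact ⟨X, fun x hx => hX x hx⟩
  · intro ε hε
    obtain ⟨C, hC⟩ := sum_div_ge hf hα hx₀
    set Z := ∑' n : ℕ, 1 / (n : ℝ) ^ 2 with hZ
    refine ⟨α / 4 * Real.exp (-(16 * H ^ 2)) * Real.exp (-(C + H + H ^ 2 * Z)), by positivity, ?_⟩
    have hLL : Tendsto (fun x : ℝ => Real.log (Real.log x)) atTop atTop :=
      Real.tendsto_log_atTop.comp Real.tendsto_log_atTop
    have hlo := hLL.eventually (Real.isLittleO_log_id_atTop.def (c := ε / H) (by positivity))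
    refine eventually_atTop.1 ?_
    filter_upwards [hlow, w_large hw 1 one_pos, hLL.eventually_ge_atTop 1,
      eventually_gt_atTop (Real.exp 1), eventually_ge_atTop 2, hlo] with x hx hwx hL hxe hx2 hlx
    have hx0 : 0 < x := by linarith
    have hL1 : 1 < Real.log x := (Real.lt_log_iff_exp_lt hx0).2 hxe
    refine le_trans ?_ hx
    have p1 := prod_ge hf (x := x) hwx.1
    have p2 := hC x hx2
    have p3 : H * Real.log (w x) ≤ ε * Real.log (Real.log x) := by
      have q1 : Real.log (w x) ≤ Real.log (Real.log (Real.log x)) :=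
        Real.log_le_log (by linarith [hwx.1]) hwx.2
      simp only [id, Real.norm_eq_abs, abs_of_nonneg (by linarith : 0 ≤ Real.log (Real.log x))]
        at hlx
      have q2 := (le_abs_self _).trans hlx
      have q3 := mul_le_mul_of_nonneg_left (q1.trans q2) (by linarith : 0 ≤ H)
      refine q3.trans (le_of_eq ?_)
      field_simp
    have p4 : Real.exp (-(C + H + H ^ 2 * Z)) * Real.log x ^ (α - ε) ≤
        ∏ p ∈ PP (w x) x, (1 + f p / p) := by
      refine le_trans ?_ p1
      rw [Real.rpow_def_of_pos (by linarith), ← Real.exp_add]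
      refine Real.exp_le_exp.2 ?_
      linarith
    have p5 : x * Real.log x ^ (α - ε - 1) = x / Real.log x * Real.log x ^ (α - ε) := by
      rw [Real.rpow_sub_one (by linarith)]
      ring
    rw [p5]
    calc _ = α / 4 * Real.exp (-(16 * H ^ 2)) * (x / Real.log x *
          (Real.exp (-(C + H + H ^ 2 * Z)) * Real.log x ^ (α - ε))) := by ring
      _ ≤ _ := by
        have : 0 ≤ x / Real.log x := by positivity
        gcongr

end
end

section
/- Let C > 1 and suppose T is sufficiently large (in terms of C and the function w). Then every integer m > (log T)^{3C} all of whose prime factors are at most w(T) has a square divisor larger than (log T)^{2C}; in particular, if additionally m < T, then m ∈ 𝒮'_C(T). -/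
open Filter Finset MeasureTheory
open scoped Classical Pointwise

noncomputable section

/-- The exceptional set `𝒮'_C(T)`: positive integers `m < T` divisible by `d²`
for some integer `d > (log T)^C`. -/
def SexcP (C T : ℝ) (m : ℤ) : Prop :=
  0 < m ∧ (m : ℝ) < T ∧ ∃ d : ℕ, (Real.log T) ^ C < (d : ℝ) ∧ (d : ℤ) ^ 2 ∣ m

def pntK (u : ℝ) : ℝ := Real.sinc (u / 2) ^ 2

lemma pntK_cont : Continuous pntK := by
  unfold pntK; have := Real.continuous_sinc; fun_prop

lemma pntK_nonneg (u : ℝ) : 0 ≤ pntK u := sq_nonneg _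

lemma pntK_bound (u : ℝ) : pntK u ≤ 8 * (1 + u ^ 2)⁻¹ := by
  rw [← div_eq_mul_inv, le_div_iff₀ (by positivity)]
  have h1 : pntK u ≤ 1 := by
    unfold pntK
    rw [sq_le_one_iff_abs_le_one]; exact Real.abs_sinc_le_one _
  have h2 : pntK u * u ^ 2 ≤ 4 := by
    unfold pntK
    by_cases hu : u = 0
    · simp [hu]
    · rw [Real.sinc_of_ne_zero (by positivity)]
      have : (Real.sin (u / 2) / (u / 2)) ^ 2 * u ^ 2 = 4 * Real.sin (u / 2) ^ 2 := by
        field_simp; ring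
      rw [this]
      nlinarith [Real.sin_sq_le_one (u / 2)]
  nlinarith

lemma pntK_integrable : Integrable pntK := by
  refine Integrable.mono' (integrable_inv_one_add_sq.const_mul 8) pntK_cont.aestronglyMeasurable ?_
  filter_upwards with u
  rw [Real.norm_of_nonneg (pntK_nonneg u)]
  exact pntK_bound u

lemma pntK_prim (a b c : ℂ) (hc : c ≠ 0) (x y : ℝ) :
    ∫ t in x..y, (a + b * (t : ℂ)) * Complex.exp (c * t) =
      ((a + b * y) / c - b / c ^ 2) * Complex.exp (c * y)
        - ((a + b * x) / c - b / c ^ 2) * Complex.exp (c * x) := by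
  have key : ∀ t : ℝ, HasDerivAt (fun t : ℝ => ((a + b * (t : ℂ)) / c - b / c ^ 2) * Complex.exp (c * t))
      ((a + b * (t : ℂ)) * Complex.exp (c * t)) t := by
    intro t
    have h0 : HasDerivAt (fun t : ℝ => (t : ℂ)) 1 t := Complex.ofRealCLM.hasDerivAt
    have h1 : HasDerivAt (fun t : ℝ => Complex.exp (c * t)) (Complex.exp (c * t) * (c * 1)) t :=
      (h0.const_mul c).cexp
    have h2 := (((h0.const_mul b).const_add a).div_const c).sub_const (b / c ^ 2)
    refine (h2.mul h1).congr_deriv ?_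
    field_simp
    ring
  rw [intervalIntegral.integral_eq_sub_of_hasDerivAt (fun t _ => key t)]
  exact (by fun_prop : Continuous _).intervalIntegrable _ _

lemma pntK_eq (u : ℝ) :
    ∫ t in (-1 : ℝ)..1, ((1 - |t| : ℝ) : ℂ) * Complex.exp (Complex.I * u * t) = pntK u := by
  have hc : Continuous fun t : ℝ => ((1 - |t| : ℝ) : ℂ) * Complex.exp (Complex.I * u * t) := by
    fun_prop
  rw [← intervalIntegral.integral_add_adjacent_intervals (hc.intervalIntegrable (-1) 0)
    (hc.intervalIntegrable 0 1)]
  have e1 : ∫ t in (-1 : ℝ)..0, ((1 - |t| : ℝ) : ℂ) * Complex.exp (Complex.I * u * t) =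
      ∫ t in (-1 : ℝ)..0, (1 + 1 * (t : ℂ)) * Complex.exp (Complex.I * u * t) := by
    refine intervalIntegral.integral_congr fun t ht => ?_
    rw [Set.uIcc_of_le (by norm_num)] at ht
    rw [abs_of_nonpos ht.2]; push_cast; ring
  have e2 : ∫ t in (0 : ℝ)..1, ((1 - |t| : ℝ) : ℂ) * Complex.exp (Complex.I * u * t) =
      ∫ t in (0 : ℝ)..1, (1 + (-1) * (t : ℂ)) * Complex.exp (Complex.I * u * t) := by
    refine intervalIntegral.integral_congr fun t ht => ?_
    rw [Set.uIcc_of_le (by norm_num)] at ht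
    rw [abs_of_nonneg ht.1]; push_cast; ring
  rw [e1, e2]
  by_cases hu : u = 0
  · subst hu
    have f1 : ∫ t in (-1 : ℝ)..0, (1 + 1 * (t : ℂ)) * Complex.exp (Complex.I * (0 : ℝ) * t) =
      ((∫ t in (-1 : ℝ)..0, (1 + t) : ℝ) : ℂ) := by
      rw [← intervalIntegral.integral_ofReal]; simp
    have f2 : ∫ t in (0 : ℝ)..1, (1 + (-1) * (t : ℂ)) * Complex.exp (Complex.I * (0 : ℝ) * t) =
      ((∫ t in (0 : ℝ)..1, (1 - t) : ℝ) : ℂ) := by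
      rw [← intervalIntegral.integral_ofReal]; simp [sub_eq_add_neg]
    rw [f1, f2, intervalIntegral.integral_add (by simp) (by simp),
      intervalIntegral.integral_sub (by simp) (by simp)]
    simp [pntK]; norm_num
  · have hu' : (u : ℂ) ≠ 0 := by exact_mod_cast hu
    have hcn : Complex.I * u ≠ 0 := mul_ne_zero Complex.I_ne_zero hu'
    rw [pntK_prim _ _ _ hcn, pntK_prim _ _ _ hcn]
    have hK : pntK u = 2 * (1 - Real.cos u) / u ^ 2 := by
      unfold pntK
      rw [Real.sinc_of_ne_zero (by positivity)]
      have : Real.cos u = 1 - 2 * Real.sin (u / 2) ^ 2 := by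
        have := Real.cos_two_mul (u / 2)
        rw [Real.cos_sq'] at this
        rw [show 2 * (u / 2) = u by ring] at this
        linarith
      rw [this]; field_simp; ring
    rw [hK]
    push_cast
    rw [Complex.cos]
    have h1 : Complex.I * (u : ℂ) * 1 = u * Complex.I := by ring
    have h2 : Complex.I * (u : ℂ) * (-1) = - u * Complex.I := by ring
    rw [h1, h2]
    simp only [mul_pow, Complex.I_sq, mul_zero, Complex.exp_zero]
    field_simp
    ring

/-- normalised Chebyshev function -/
def pntB (v : ℝ) : ℝ := Chebyshev.psi (Real.exp v) * Real.exp (-v)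

lemma pntB_nonneg (v : ℝ) : 0 ≤ pntB v :=
  mul_nonneg (Chebyshev.psi_nonneg _) (Real.exp_pos _).le

lemma pntB_meas : Measurable pntB := by
  unfold pntB
  have := Chebyshev.psi_mono.measurable
  fun_prop

lemma pntB_bound : ∃ M : ℝ, 0 ≤ M ∧ ∀ v, |pntB v - 1| ≤ M := by
  refine ⟨Real.log 4 + 5, by positivity, fun v => ?_⟩
  have h := Chebyshev.psi_le_const_mul_self (Real.exp_pos v).le
  have h2 : pntB v ≤ Real.log 4 + 4 := by
    unfold pntB
    calc _ ≤ (Real.log 4 + 4) * Real.exp v * Real.exp (-v) := by gcongr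
      _ = _ := by rw [mul_assoc, ← Real.exp_add]; simp
  have h3 := pntB_nonneg v
  have : 0 ≤ Real.log 4 := Real.log_nonneg (by norm_num)
  rw [abs_le]; constructor <;> linarith

lemma pntB_slow {u v : ℝ} (h : u ≤ v) : pntB u * Real.exp (u - v) ≤ pntB v := by
  unfold pntB
  rw [mul_assoc, ← Real.exp_add]
  have : -u + (u - v) = -v := by ring
  rw [this]
  have := Chebyshev.psi_mono (Real.exp_le_exp.2 h)
  gcongr

/-- continuous boundary function -/
def pntg (s : ℂ) : ℂ :=
  (ArithmeticFunction.vonMangoldt.LFunctionResidueClassAux (q := 1) 0 s - 1) / s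

lemma pntg_cont : ContinuousOn pntg {s | 1 ≤ s.re} := by
  unfold pntg
  refine ContinuousOn.div ?_ continuousOn_id ?_
  · exact (ArithmeticFunction.vonMangoldt.continuousOn_LFunctionResidueClassAux (q := 1) 0).sub
      continuousOn_const
  · intro s hs h
    simp only [Set.mem_ofPred_eq] at hs
    rw [h] at hs; norm_num at hs

lemma pnt_exp_int {s : ℂ} (hs : 1 < s.re) :
    ∫ v in Set.Ioi (0 : ℝ), Complex.exp (-(s - 1) * v) = 1 / (s - 1) := by
  have h := integral_exp_mul_complex_Ioi (a := -(s - 1)) (by simpa using hs) 0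
  rw [h]
  have : s - 1 ≠ 0 := by
    intro h
    have := sub_eq_zero.1 h
    rw [this] at hs; simp at hs
  rw [Complex.ofReal_zero, mul_zero, Complex.exp_zero, neg_div_neg_eq]

lemma pnt_L {s : ℂ} (hs : 1 < s.re) :
    LSeries (fun n => ((ArithmeticFunction.vonMangoldt n : ℝ) : ℂ)) s =
     s * ∫ v in Set.Ioi (0 : ℝ), (pntB v : ℂ) * Complex.exp (-(s - 1) * v) := by
  have hO : (fun n : ℕ ↦ ∑ k ∈ Icc 1 n, ArithmeticFunction.vonMangoldt k)
      =O[atTop] fun n ↦ (n : ℝ) ^ (1 : ℝ) := by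
    refine Asymptotics.IsBigO.of_bound (Real.log 4 + 4) ?_
    filter_upwards with n
    have h := Chebyshev.psi_le_const_mul_self (x := n) (by positivity)
    rw [Chebyshev.psi] at h
    rw [Nat.floor_natCast] at h
    have e : Icc 1 n = Ioc 0 n := rfl
    rw [e, Real.norm_of_nonneg (sum_nonneg fun _ _ => ArithmeticFunction.vonMangoldt_nonneg)]
    simpa using h
  rw [LSeries_eq_mul_integral_of_nonneg _ zero_le_one hs hO
    (fun _ => ArithmeticFunction.vonMangoldt_nonneg)]
  congr 1
  have him : Set.image Real.exp (Set.Ioi 0) = Set.Ioi 1 := by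
    ext y; simp only [Set.mem_image, Set.mem_Ioi]
    constructor
    · rintro ⟨x, hx, rfl⟩; exact Real.one_lt_exp_iff.2 hx
    · intro hy; exact ⟨Real.log y, Real.log_pos hy, Real.exp_log (by linarith)⟩
  rw [← him, integral_image_eq_integral_abs_deriv_smul measurableSet_Ioi
    (fun x _ => (Real.hasDerivAt_exp x).hasDerivWithinAt) Real.exp_injective.injOn]
  refine setIntegral_congr_fun measurableSet_Ioi fun v _ => ?_
  rw [abs_of_pos (Real.exp_pos v), pntB, Chebyshev.psi]
  have e : Icc 1 ⌊Real.exp v⌋₊ = Ioc 0 ⌊Real.exp v⌋₊ := rfl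
  rw [e, Complex.real_smul]
  push_cast
  have h3 : (Complex.exp (v : ℂ)) ^ (-(s + 1)) = Complex.exp (-(s+1) * v) := by
    rw [← Complex.ofReal_exp, Complex.cpow_def_of_ne_zero (by exact_mod_cast (Real.exp_pos v).ne'),
      ← Complex.ofReal_log (Real.exp_pos v).le, Real.log_exp, mul_comm]
  rw [h3]
  rw [mul_comm (Complex.exp _), mul_assoc, mul_assoc, ← Complex.exp_add, ← Complex.exp_add]
  congr 2; ring

lemma pnt_laplace_int (s : ℂ) (hs : 1 < s.re) :
    IntegrableOn (fun v : ℝ => ((pntB v - 1 : ℝ) : ℂ) * Complex.exp (-(s - 1) * v)) (Set.Ioi 0) := by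
  obtain ⟨M, hM, hb⟩ := pntB_bound
  refine Integrable.bdd_mul (c := M) ?_ ?_ ?_
  · exact integrableOn_exp_mul_complex_Ioi (a := -(s - 1)) (by simpa using hs) 0
  · have := pntB_meas
    exact (by fun_prop : Measurable _).aestronglyMeasurable
  · filter_upwards with v
    rw [Complex.norm_real]; exact hb v

lemma pnt_laplace (s : ℂ) (hs : 1 < s.re) :
    ∫ v in Set.Ioi (0 : ℝ), ((pntB v - 1 : ℝ) : ℂ) * Complex.exp (-(s - 1) * v) = pntg s := by
  have hE : IntegrableOn (fun v : ℝ => Complex.exp (-(s - 1) * v)) (Set.Ioi 0) :=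
    integrableOn_exp_mul_complex_Ioi (a := -(s - 1)) (by simpa using hs) 0
  have h1 : ∫ v in Set.Ioi (0 : ℝ), (pntB v : ℂ) * Complex.exp (-(s - 1) * v) =
      (∫ v in Set.Ioi (0 : ℝ), ((pntB v - 1 : ℝ) : ℂ) * Complex.exp (-(s - 1) * v))
       + 1 / (s - 1) := by
    rw [← pnt_exp_int hs, ← integral_add (pnt_laplace_int s hs) hE]
    congr 1; ext v; push_cast; ring
  have h2 := pnt_L hs
  have h3 := ArithmeticFunction.vonMangoldt.eqOn_LFunctionResidueClassAux (q := 1) (a := 0)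
    (isUnit_of_subsingleton _) hs
  simp only at h3
  have h4 : ∀ n, ArithmeticFunction.vonMangoldt.residueClass (0 : ZMod 1) n
      = ArithmeticFunction.vonMangoldt n := by
    intro n
    rw [ArithmeticFunction.vonMangoldt.residueClass, Set.indicator_of_mem]
    exact Subsingleton.elim _ _
  simp only [h4] at h3
  rw [h2, h1] at h3
  have hs0 : s ≠ 0 := by rintro rfl; norm_num at hs
  have hs1 : s - 1 ≠ 0 := by
    intro h
    have := sub_eq_zero.1 h
    rw [this] at hs; simp at hs
  unfold pntg
  rw [h3]
  simp
  field_simp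
  ring

lemma pnt_fubini (l u e : ℝ) (he : 0 < e) :
    ∫ v in Set.Ioi (0 : ℝ), (((pntB v - 1) * Real.exp (-e * v) * pntK (l * (u - v)) : ℝ) : ℂ) =
    ∫ t in (-1 : ℝ)..1, ((1 - |t| : ℝ) : ℂ) * Complex.exp (Complex.I * (l * u : ℝ) * t)
      * pntg (1 + e + Complex.I * (l * t : ℝ)) := by
  have hg : ∀ t : ℝ, pntg (1 + e + Complex.I * (l * t : ℝ)) =
      ∫ v in Set.Ioi (0 : ℝ), ((pntB v - 1 : ℝ) : ℂ) *
        Complex.exp (-((1 + e + Complex.I * (l * t : ℝ)) - 1) * v) := by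
    intro t
    rw [pnt_laplace]
    simp [he]
  simp_rw [hg, ← integral_const_mul]
  rw [intervalIntegral_integral_swap]
  · refine integral_congr_ae ?_
    filter_upwards with v
    push_cast
    rw [← pntK_eq, ← intervalIntegral.integral_const_mul]
    congr 1; ext t
    have : -(1 + (e : ℂ) + Complex.I * (l * t) - 1) * v =
      -e * v + (- Complex.I * (l * t) * v) := by ring
    push_cast
    rw [this, Complex.exp_add]
    have : Complex.I * (l * (u - v)) * t = Complex.I * (l * u) * t + (- Complex.I * (l * t) * v) := by ring
    rw [this, Complex.exp_add]
    ring
  · obtain ⟨M, hM, hb⟩ := pntB_bound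
    have i1 : Integrable (fun t : ℝ => abs (1 - abs t)) (volume.restrict (Set.uIoc (-1) 1)) := by
      have : Continuous (fun t : ℝ => abs (1 - abs t)) := by fun_prop
      exact this.integrableOn_uIoc
    have i2 : Integrable (fun v : ℝ => M * Real.exp (-e * v)) (volume.restrict (Set.Ioi 0)) :=
      (integrableOn_exp_mul_Ioi (by linarith) 0).const_mul M
    refine Integrable.mono' (i1.mul_prod i2) ?_ ?_
    · have := pntB_meas
      refine Measurable.aestronglyMeasurable ?_
      unfold Function.uncurry
      fun_prop
    · filter_upwards with ⟨t, v⟩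
      simp only [Function.uncurry, norm_mul, Complex.norm_real, Real.norm_eq_abs, Complex.norm_exp]
      have e1 : (Complex.I * ((l * u : ℝ) : ℂ) * t).re = 0 := by simp
      have e2 : (-(1 + (e : ℂ) + Complex.I * ((l * t : ℝ) : ℂ) - 1) * v).re = -e * v := by simp
      rw [e1, e2, Real.exp_zero, mul_one]
      gcongr
      exact hb v

lemma pnt_Kshift_int (l u : ℝ) (hl : 0 < l) : Integrable (fun v => pntK (l * (u - v))) :=
  (pntK_integrable.comp_mul_left' hl.ne').comp_sub_left u

lemma pntBK_int (l u : ℝ) (hl : 0 < l) :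
    Integrable (fun v => (pntB v - 1) * pntK (l * (u - v))) := by
  obtain ⟨M, hM, hb⟩ := pntB_bound
  refine Integrable.bdd_mul (c := M) (pnt_Kshift_int l u hl) ?_ ?_
  · have := pntB_meas
    exact (by fun_prop : Measurable _).aestronglyMeasurable
  · filter_upwards with v
    exact hb v

lemma pnt_lim (l u : ℝ) (hl : 0 < l) :
    ∫ v in Set.Ioi (0 : ℝ), (((pntB v - 1) * pntK (l * (u - v)) : ℝ) : ℂ) =
    ∫ t in (-1 : ℝ)..1, ((1 - |t| : ℝ) : ℂ) * Complex.exp (Complex.I * (l * u : ℝ) * t)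
      * pntg (1 + Complex.I * (l * t : ℝ)) := by
  have hG : Continuous fun p : ℝ × ℝ => pntg (1 + (|p.1| : ℝ) + Complex.I * (l * p.2 : ℝ)) := by
    refine pntg_cont.comp_continuous (by fun_prop) ?_
    intro p; simp
  have hR : Continuous fun e : ℝ => ∫ t in (-1 : ℝ)..1, ((1 - |t| : ℝ) : ℂ) *
      Complex.exp (Complex.I * (l * u : ℝ) * t) * pntg (1 + (|e| : ℝ) + Complex.I * (l * t : ℝ)) := by
    refine intervalIntegral.continuous_parametric_intervalIntegral_of_continuous' ?_ _ _
    unfold Function.uncurry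
    exact Continuous.mul (by fun_prop) hG
  have hR0 := (hR.tendsto 0).mono_left (nhdsWithin_le_nhds (s := Set.Ioi 0))
  simp only [abs_zero, Complex.ofReal_zero, add_zero] at hR0
  have hL : Tendsto (fun e : ℝ => ∫ v in Set.Ioi (0 : ℝ),
      (((pntB v - 1) * Real.exp (-e * v) * pntK (l * (u - v)) : ℝ) : ℂ)) (nhdsWithin 0 (Set.Ioi 0))
      (nhds (∫ v in Set.Ioi (0 : ℝ), (((pntB v - 1) * pntK (l * (u - v)) : ℝ) : ℂ))) := by
    refine tendsto_integral_filter_of_dominated_convergence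
      (fun v => |(pntB v - 1) * pntK (l * (u - v))|) ?_ ?_ ?_ ?_
    · filter_upwards with e
      have := pntB_meas
      have := pntK_cont.measurable
      exact (by fun_prop : Measurable _).aestronglyMeasurable
    · filter_upwards [self_mem_nhdsWithin] with e he
      filter_upwards [ae_restrict_mem measurableSet_Ioi] with v hv
      rw [Complex.norm_real, Real.norm_eq_abs]
      have he : 0 < e := he
      have hv : 0 < v := hv
      have h1 : Real.exp (-e * v) ≤ 1 := Real.exp_le_one_iff.2 (by nlinarith)
      rw [abs_mul, abs_mul, abs_mul, abs_of_pos (Real.exp_pos _)]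
      have : |pntB v - 1| * Real.exp (-e * v) ≤ |pntB v - 1| :=
        mul_le_of_le_one_right (abs_nonneg _) h1
      gcongr
    · exact (pntBK_int l u hl).abs.integrableOn
    · filter_upwards with v
      have : Continuous fun e : ℝ =>
        (((pntB v - 1) * Real.exp (-e * v) * pntK (l * (u - v)) : ℝ) : ℂ) := by fun_prop
      have := (this.tendsto 0).mono_left (nhdsWithin_le_nhds (s := Set.Ioi 0))
      simpa using this
  refine tendsto_nhds_unique hL (hR0.congr' ?_)
  filter_upwards [self_mem_nhdsWithin] with e he
  rw [pnt_fubini l u e he, abs_of_pos he]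

lemma pnt_tendsto (l : ℝ) (hl : 0 < l) :
    Tendsto (fun u => ∫ v in Set.Ioi (0 : ℝ), (pntB v - 1) * pntK (l * (u - v))) atTop (nhds 0) := by
  have hRL := Real.tendsto_integral_exp_smul_cocompact
    (Set.indicator (Set.Ioc (-1 : ℝ) 1) fun t : ℝ =>
      ((1 - |t| : ℝ) : ℂ) * pntg (1 + Complex.I * (l * t : ℝ)))
  have hw : Tendsto (fun u : ℝ => -(l / (2 * Real.pi)) * u) atTop (cocompact ℝ) :=
    (tendsto_id.const_mul_atTop_of_neg (by have := Real.pi_pos; simp; positivity)).mono_right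
      atBot_le_cocompact
  have h2 := (hRL.comp hw).norm
  rw [norm_zero] at h2
  refine tendsto_zero_iff_norm_tendsto_zero.2 (h2.congr fun u => ?_)
  rw [← Complex.norm_real (∫ v in Set.Ioi (0 : ℝ), (pntB v - 1) * pntK (l * (u - v))),
    ← integral_complex_ofReal, pnt_lim l u hl, intervalIntegral.integral_of_le (by norm_num),
    ← integral_indicator measurableSet_Ioc]
  simp only [Function.comp]
  congr 2; ext t
  by_cases ht : t ∈ Set.Ioc (-1 : ℝ) 1
  · rw [Set.indicator_of_mem ht, Set.indicator_of_mem ht, Circle.smul_def, Real.fourierChar_apply,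
      smul_eq_mul]
    have : ((2 * Real.pi * -(t * (-(l / (2 * Real.pi)) * u)) : ℝ) : ℂ) * Complex.I
       = Complex.I * (l * u : ℝ) * t := by
      have : (2 * Real.pi * -(t * (-(l / (2 * Real.pi)) * u)) : ℝ) = l * u * t := by
        have := Real.pi_pos; field_simp
      rw [this]; push_cast; ring
    rw [this]; ring
  · simp [Set.indicator_of_notMem ht]

lemma pnt_upper (l d : ℝ) (hl : 0 < l) (hd : 0 < d) (η : ℝ) (hη : 0 < η) :
    ∀ᶠ u in atTop, pntB u * (Real.exp (-(2 * d)) * ∫ y in (-(l * d))..(l * d), pntK y)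
      ≤ (∫ y, pntK y) + η := by
  have h1 := (pnt_tendsto l hl).comp (tendsto_atTop_add_const_right atTop d tendsto_id)
  have h2 := h1.eventually_lt_const (show 0 < η / l by positivity)
  filter_upwards [h2, eventually_ge_atTop 0] with u hu hu0
  simp only [Function.comp, id] at hu
  set U := u + d with hU
  have i1 := pnt_Kshift_int l U hl
  have i2 := pntBK_int l U hl
  have i3 : Integrable (fun v => pntB v * pntK (l * (U - v))) := by
    refine (i2.add i1).congr ?_
    filter_upwards with v
    simp only [Pi.add_apply]; ring
  have e1 : ∫ v in Set.Ioi (0 : ℝ), (pntB v - 1) * pntK (l * (U - v)) =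
    (∫ v in Set.Ioi (0 : ℝ), pntB v * pntK (l * (U - v))) -
      ∫ v in Set.Ioi (0 : ℝ), pntK (l * (U - v)) := by
    rw [← integral_sub i3.integrableOn i1.integrableOn]
    congr 1; ext v; ring
  have e2 : ∫ v in Set.Ioi (0 : ℝ), pntK (l * (U - v)) ≤ l⁻¹ * ∫ y, pntK y := by
    calc _ ≤ ∫ v, pntK (l * (U - v)) :=
          setIntegral_le_integral i1 (by filter_upwards with v using pntK_nonneg _)
      _ = ∫ v, pntK (l * v) := integral_sub_left_eq_self (fun v => pntK (l * v)) volume U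
      _ = _ := by
        rw [Measure.integral_comp_mul_left, abs_of_pos (by positivity), smul_eq_mul]
  have e3 : pntB u * (Real.exp (-(2 * d)) * (l⁻¹ * ∫ y in (-(l * d))..(l * d), pntK y)) ≤
      ∫ v in Set.Ioi (0 : ℝ), pntB v * pntK (l * (U - v)) := by
    have hk : ∫ v in u..(u + 2 * d), pntK (l * (U - v)) = l⁻¹ * ∫ y in (-(l * d))..(l * d), pntK y := by
      rw [intervalIntegral.integral_comp_sub_left (fun v => pntK (l * v)),
        intervalIntegral.integral_comp_mul_left _ hl.ne', smul_eq_mul]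
      congr 2 <;> rw [hU] <;> ring
    calc _ = ∫ v in u..(u + 2 * d), pntB u * Real.exp (-(2 * d)) * pntK (l * (U - v)) := by
          rw [intervalIntegral.integral_const_mul, hk]; ring
      _ ≤ ∫ v in u..(u + 2 * d), pntB v * pntK (l * (U - v)) := by
          refine intervalIntegral.integral_mono_on (by linarith)
            (i1.const_mul _).intervalIntegrable i3.intervalIntegrable ?_
          intro v hv
          refine mul_le_mul_of_nonneg_right ?_ (pntK_nonneg _)
          refine le_trans ?_ (pntB_slow hv.1)
          refine mul_le_mul_of_nonneg_left (Real.exp_le_exp.2 ?_) (pntB_nonneg _)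
          linarith [hv.2]
      _ = ∫ v in Set.Ioc u (u + 2 * d), pntB v * pntK (l * (U - v)) :=
          intervalIntegral.integral_of_le (by linarith)
      _ ≤ _ := by
          refine setIntegral_mono_set i3.integrableOn ?_ ?_
          · filter_upwards with v using mul_nonneg (pntB_nonneg _) (pntK_nonneg _)
          · exact LE.le.eventuallyLE fun v hv => lt_of_le_of_lt hu0 hv.1
  rw [e1] at hu
  have e4 : l⁻¹ * (pntB u * (Real.exp (-(2 * d)) * ∫ y in (-(l * d))..(l * d), pntK y)) ≤
      l⁻¹ * ((∫ y, pntK y) + η) := by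
    have : l⁻¹ * η = η / l := by ring
    rw [mul_add, this]
    linarith
  exact le_of_mul_le_mul_left e4 (by positivity)

lemma pntK_int_pos : 0 < ∫ y, pntK y := by
  exact integral_pos_of_integrable_nonneg_nonzero (x := 0) pntK_cont pntK_integrable
    pntK_nonneg (by simp [pntK])

lemma pnt_limsup (C : ℝ) (hC : 1 < C) : ∀ᶠ u in atTop, pntB u ≤ C := by
  have hI := pntK_int_pos
  set I := ∫ y, pntK y with hIdef
  obtain ⟨d, hd, hdC⟩ : ∃ d : ℝ, 0 < d ∧ 1 < C * Real.exp (-(2 * d)) := by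
    refine ⟨Real.log C / 4, by have := Real.log_pos hC; positivity, ?_⟩
    have h0 := Real.log_pos hC
    nth_rw 1 [← Real.exp_log (show 0 < C by linarith)]
    rw [← Real.exp_add]
    apply Real.one_lt_exp_iff.2
    linarith
  set q := C * Real.exp (-(2 * d)) with hq
  have ht : Tendsto (fun l : ℝ => q * ∫ y in (-(l * d))..(l * d), pntK y) atTop (nhds (q * I)) := by
    refine (intervalIntegral_tendsto_integral pntK_integrable ?_ ?_).const_mul q
    · exact tendsto_neg_atTop_atBot.comp (tendsto_id.atTop_mul_const hd)
    · exact tendsto_id.atTop_mul_const hd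
  obtain ⟨l, hlq, hl⟩ := ((ht.eventually_const_lt (show I < q * I by nlinarith)).and
    (eventually_gt_atTop 0)).exists
  have hu := pnt_upper l d hl hd (q * (∫ y in (-(l * d))..(l * d), pntK y) - I) (by linarith)
  filter_upwards [hu] with u hu
  set J := ∫ y in (-(l * d))..(l * d), pntK y
  have hJ : 0 < Real.exp (-(2 * d)) * J := by
    have : 0 < q := by linarith
    have : 0 < J := by
      by_contra h
      push Not at h
      nlinarith
    positivity
  refine le_of_mul_le_mul_right ?_ hJ
  calc _ ≤ _ := hu
    _ = _ := by rw [hq]; ring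

lemma pnt_theta (C : ℝ) (hC : 1 < C) : ∀ᶠ x in atTop, Chebyshev.theta x ≤ C * x := by
  have h := Real.tendsto_log_atTop.eventually (pnt_limsup C hC)
  filter_upwards [h, eventually_gt_atTop 0] with x hx h0
  refine (Chebyshev.theta_le_psi x).trans ?_
  rw [pntB, Real.exp_neg, Real.exp_log h0, ← div_eq_mul_inv, div_le_iff₀ h0] at hx
  exact hx

/-- Lemma 2.3: for `C > 1` and `T` sufficiently large, every integer
`m > (log T)^{3C}` all of whose prime factors are at most `w(T)` has a square
divisor larger than `(log T)^{2C}`; in particular, if moreover `m < T`, then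
`m ∈ 𝒮'_C(T)`. -/
theorem stmt_5 (w : ℝ → ℝ) (hw : GoodW w) (C : ℝ) (hC : 1 < C) :
    ∃ T₀ : ℝ, ∀ T ≥ T₀, ∀ m : ℕ,
      (Real.log T) ^ (3 * C) < (m : ℝ) →
      (∀ p : ℕ, p.Prime → p ∣ m → (p : ℝ) ≤ w T) →
      (∃ d : ℕ, (Real.log T) ^ (2 * C) < (d : ℝ) ^ 2 ∧ d ^ 2 ∣ m) ∧
      ((m : ℝ) < T → SexcP C T (m : ℤ)) := by
  obtain ⟨x₀, hx₀⟩ := hw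
  have h1 := (Real.tendsto_log_atTop.comp Real.tendsto_log_atTop).eventually (pnt_theta C hC)
  obtain ⟨T₀, hT₀⟩ := eventually_atTop.1 ((h1.and (eventually_ge_atTop x₀)).and
    (Real.tendsto_log_atTop.eventually_gt_atTop 0))
  refine ⟨T₀, fun T hT m hm hp => ?_⟩
  obtain ⟨⟨hth, hTx⟩, hL⟩ := hT₀ T hT
  simp only [Function.comp] at hth
  have hwT := (hx₀ T hTx).2
  set L := Real.log T with hLdef
  set y := Real.log L with hy
  have hmpos : 0 < m := by
    have : (0 : ℝ) < m := lt_trans (Real.rpow_pos_of_pos hL _) hm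
    exact_mod_cast this
  obtain ⟨a, b, ha, hb, hab, hsq⟩ := Nat.sq_mul_squarefree_of_pos hmpos
  have hadvd : a ∣ primorial ⌊y⌋₊ := by
    rw [← Nat.prod_primeFactors_of_squarefree hsq, primorial]
    refine Finset.prod_dvd_prod_of_subset _ _ _ ?_
    intro p hpa
    have hpp := Nat.prime_of_mem_primeFactors hpa
    have hpd := Nat.dvd_of_mem_primeFactors hpa
    have := hp p hpp (hpd.trans (hab ▸ Dvd.intro_left _ rfl))
    have h2 : p ≤ ⌊y⌋₊ := Nat.le_floor (this.trans hwT)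
    simp only [mem_filter, mem_range]
    exact ⟨by omega, hpp⟩
  have hapos : (0 : ℝ) < a := by exact_mod_cast ha
  have haL : (a : ℝ) ≤ L ^ C := by
    have h2 : (a : ℝ) ≤ primorial ⌊y⌋₊ := by
      exact_mod_cast Nat.le_of_dvd (primorial_pos _) hadvd
    have h3 := Real.log_le_log hapos h2
    rw [← Chebyshev.theta_eq_log_primorial] at h3
    rw [Real.rpow_def_of_pos hL, ← Real.log_le_iff_le_exp hapos]
    rw [mul_comm]
    exact h3.trans hth
  have hmain : L ^ (2 * C) < (b : ℝ) ^ 2 := by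
    have h2 : (b : ℝ) ^ 2 * a = m := by exact_mod_cast hab
    have h3 : L ^ (3 * C) = L ^ (2 * C) * L ^ C := by
      rw [← Real.rpow_add hL]; congr 1; ring
    by_contra hcon
    push Not at hcon
    have : (b : ℝ) ^ 2 * a ≤ L ^ (2 * C) * L ^ C := by gcongr
    linarith
  refine ⟨⟨b, hmain, hab ▸ Dvd.intro _ rfl⟩, fun hmT => ⟨by exact_mod_cast hmpos, by simpa using hmT, b, ?_, ?_⟩⟩
  · have : L ^ (2 * C) = (L ^ C) ^ 2 := by
      rw [← Real.rpow_natCast, ← Real.rpow_mul hL.le]; congr 1; push_cast; ring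
    rw [this] at hmain
    exact lt_of_pow_lt_pow_left₀ 2 (by positivity) hmain
  · exact_mod_cast (hab ▸ Dvd.intro _ rfl : b ^ 2 ∣ m)


end
end

section
/- Let γ ∈ (0, 1/2) be fixed and let 𝒫 be any set of primes. For x > 1 and ξ ∈ ℝ set s = 1 + (1 + iξ)/(γ log x). Then for all sufficiently large x and all ξ ∈ ℝ one has |∏_{p > w(x), p ∈ 𝒫} (1 − p^{−s})| ≪_γ |1 + iξ| · ∏_{w(x) < p < x^γ, p ∈ 𝒫} (1 − 1/p), where the product on the left is the (absolutely convergent) product over all primes p > w(x) in 𝒫. -/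
open Filter Finset MeasureTheory
open scoped Classical Pointwise

noncomputable section

lemma aux_rpow_tel (n : ℕ) (hn : 1 ≤ n) :
    (n : ℝ) ^ (-(7/4) : ℝ) ≤ 16/3 * ((n : ℝ) ^ (-(3/4) : ℝ) - ((n + 1 : ℕ) : ℝ) ^ (-(3/4) : ℝ)) := by
  have hn0 : (0 : ℝ) < n := by exact_mod_cast hn
  have hn1 : (1 : ℝ) ≤ n := by exact_mod_cast hn
  have hd : ∀ u : ℝ, (n : ℝ) ≤ u → HasDerivAt (fun u : ℝ => u ^ (-(3/4) : ℝ))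
      ((-(3/4) : ℝ) * u ^ (-(3/4) - 1 : ℝ)) u := fun u hu =>
    Real.hasDerivAt_rpow_const (Or.inl (by linarith))
  obtain ⟨c, hc, hc'⟩ := exists_hasDerivAt_eq_slope (fun u : ℝ => u ^ (-(3/4) : ℝ))
    (fun u : ℝ => (-(3/4) : ℝ) * u ^ (-(3/4) - 1 : ℝ)) (a := (n : ℝ)) (b := (n : ℝ) + 1) (by linarith)
    (fun u hu => (hd u hu.1).continuousAt.continuousWithinAt)
    (fun u hu => hd u hu.1.le)
  have h1 : c ^ (-(7/4) : ℝ) ≥ (2 * n : ℝ) ^ (-(7/4) : ℝ) := by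
    apply Real.rpow_le_rpow_of_nonpos <;> linarith [hc.1, hc.2]
  rw [Real.mul_rpow (by norm_num) hn0.le] at h1
  have h2 : (1/4 : ℝ) ≤ (2 : ℝ) ^ (-(7/4) : ℝ) := by
    calc (1/4 : ℝ) = (2 : ℝ) ^ (-2 : ℝ) := by
          rw [Real.rpow_neg (by norm_num)]; norm_num
      _ ≤ _ := Real.rpow_le_rpow_of_exponent_le (by norm_num) (by norm_num)
  have h3 : (0:ℝ) < (n : ℝ) ^ (-(7/4) : ℝ) := by positivity
  norm_num at hc' h1 h2 h3 ⊢
  nlinarith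

lemma aux_rpow_head (N : ℕ) :
    ∑ n ∈ Finset.range N, ((n : ℝ) + 1) ^ (-(3/4) : ℝ) ≤ 4 * (N : ℝ) ^ (1/4 : ℝ) := by
  induction N with
  | zero => simp
  | succ N ih =>
    rw [Finset.sum_range_succ]
    have hN : (0 : ℝ) ≤ N := by positivity
    push_cast
    have hb : ((N : ℝ) ^ (1/4 : ℝ)) ^ 4 = N := by
      rw [← Real.rpow_natCast, ← Real.rpow_mul hN]; norm_num
    have ha : (((N : ℝ) + 1) ^ (1/4 : ℝ)) ^ 4 = N + 1 := by
      rw [← Real.rpow_natCast, ← Real.rpow_mul (by positivity)]; norm_num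
    have hc : ((N : ℝ) + 1) ^ (-(3/4) : ℝ) = ((((N : ℝ) + 1) ^ (1/4 : ℝ)) ^ 3)⁻¹ := by
      rw [← Real.rpow_natCast, ← Real.rpow_mul (by positivity), ← Real.rpow_neg (by positivity)]
      norm_num
    rw [hc]
    have hb0 : 0 ≤ (N : ℝ) ^ (1/4 : ℝ) := by positivity
    have ha0 : 0 < ((N : ℝ) + 1) ^ (1/4 : ℝ) := by positivity
    have hab : (N : ℝ) ^ (1/4 : ℝ) ≤ ((N : ℝ) + 1) ^ (1/4 : ℝ) :=
      Real.rpow_le_rpow hN (by linarith) (by norm_num)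
    set a := ((N : ℝ) + 1) ^ (1/4 : ℝ)
    set b := (N : ℝ) ^ (1/4 : ℝ)
    have : (a ^ 3)⁻¹ ≤ 4 * (a - b) := by
      rw [inv_le_iff_one_le_mul₀ (by positivity)]
      have e : 1 = (a - b) * (a^3 + a^2*b + a*b^2+b^3) := by nlinarith
      have h1 : a^2*b ≤ a^3 := by nlinarith [sq_nonneg a]
      have h2 : a*b^2 ≤ a^3 := by nlinarith [mul_nonneg ha0.le hb0]
      have h3 : b^3 ≤ a^3 := by gcongr
      nlinarith
    linarith

lemma aux_generic (f F f' : ℝ → ℂ) (N : ℕ) (hN : 1 ≤ N) (A B D : ℝ) (hA : 0 ≤ A) (hB : 0 ≤ B)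
    (hF : ∀ u : ℝ, 1 ≤ u → HasDerivAt F (f u) u)
    (hf : ∀ u : ℝ, 1 ≤ u → HasDerivAt f (f' u) u)
    (hf' : ∀ u : ℝ, 1 ≤ u → ‖f' u‖ ≤ A * N * u ^ (-(7/4) : ℝ))
    (hfb : ∀ u : ℝ, 1 ≤ u → ‖f u‖ ≤ B * u ^ (-(3/4) : ℝ))
    (hFN : ‖F N‖ ≤ D * (N : ℝ) ^ (1/4 : ℝ))
    (hF0 : Tendsto F atTop (nhds 0)) (S : ℂ)
    (hS : HasSum (fun n : ℕ => f (n + 1)) S) :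
    ‖S‖ ≤ (4 * B + D + 6 * A) * (N : ℝ) ^ (1/4 : ℝ) := by
  have hN0 : (0:ℝ) < N := by exact_mod_cast hN
  -- single step
  have step : ∀ n : ℕ, 1 ≤ n → ‖f (n + 1) - (F ((n + 1 : ℕ) : ℝ) - F n)‖ ≤
      A * N * (n : ℝ) ^ (-(7/4) : ℝ) := by
    intro n hn
    have hn1 : (1 : ℝ) ≤ n := by exact_mod_cast hn
    have hfd : ∀ u ∈ Set.Icc (n : ℝ) (n + 1), ‖f (n+1) - f u‖ ≤ A * N * (n : ℝ) ^ (-(7/4) : ℝ) := by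
      intro u hu
      have := (convex_Icc (n : ℝ) (n + 1)).norm_image_sub_le_of_norm_hasDerivWithin_le
        (f := f) (f' := f') (C := A * N * (n : ℝ) ^ (-(7/4) : ℝ)) (x := u) (y := n + 1)
        (fun v hv => (hf v (hn1.trans hv.1)).hasDerivWithinAt)
        (fun v hv => (hf' v (hn1.trans hv.1)).trans (by
          have := Real.rpow_le_rpow_of_nonpos (by linarith : (0:ℝ) < n) hv.1 (by norm_num : (-(7/4) : ℝ) ≤ 0)
          gcongr)) hu ⟨by linarith, le_rfl⟩
      refine this.trans ?_
      have h1 : ‖(n : ℝ) + 1 - u‖ ≤ 1 := by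
        rw [Real.norm_eq_abs, abs_le]; constructor <;> linarith [hu.1, hu.2]
      exact mul_le_of_le_one_right (by positivity) h1
    have := (convex_Icc (n : ℝ) (n + 1)).norm_image_sub_le_of_norm_hasDerivWithin_le
        (f := fun u : ℝ => (u : ℂ) * f (n+1) - F u) (f' := fun u => f (n+1) - f u)
        (C := A * N * (n : ℝ) ^ (-(7/4) : ℝ)) (x := n) (y := n + 1)
        (fun v hv => by
          have h1 : HasDerivAt (fun u : ℝ => (u : ℂ)) 1 v := Complex.ofRealCLM.hasDerivAt
          have := ((h1.mul_const (f (n+1))).sub (hF v (hn1.trans hv.1)))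
          rw [one_mul] at this
          exact this.hasDerivWithinAt)
        hfd ⟨le_rfl, by linarith⟩ ⟨by linarith, le_rfl⟩
    have e : (((n : ℝ) + 1 : ℝ) : ℂ) * f (n+1) - F ((n:ℝ) + 1) - ((n : ℝ) * f (n+1) - F n) =
      f (n + 1) - (F ((n + 1 : ℕ) : ℝ) - F n) := by push_cast; ring
    rw [← e]
    simpa using this
  have part : ∀ k : ℕ, ‖∑ n ∈ Finset.range k, f ((N + n : ℕ) + 1) - (F ((N + k : ℕ) : ℝ) - F N)‖ ≤
      A * N * (16/3 * ((N : ℝ) ^ (-(3/4) : ℝ) - ((N + k : ℕ) : ℝ) ^ (-(3/4) : ℝ))) := by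
    intro k
    induction k with
    | zero => simp
    | succ k ih =>
      rw [Finset.sum_range_succ]
      have h1 := step (N + k) (by omega)
      have h2 := mul_le_mul_of_nonneg_left (aux_rpow_tel (N + k) (by omega)) (by positivity : 0 ≤ A * N)
      have e : ∑ n ∈ Finset.range k, f ((N + n : ℕ) + 1) + f ((N + k : ℕ) + 1) - (F ((N + (k+1) : ℕ) : ℝ) - F N) =
        (∑ n ∈ Finset.range k, f ((N + n : ℕ) + 1) - (F ((N + k : ℕ) : ℝ) - F N)) +
         (f ((N + k : ℕ) + 1) - (F ((N + k + 1 : ℕ) : ℝ) - F (N + k : ℕ))) := by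
        rw [← add_assoc N k 1]; ring
      rw [e, ← add_assoc N k 1]
      refine (norm_add_le _ _).trans ?_
      linarith
  have e14 : (N : ℝ) * (N : ℝ) ^ (-(3/4) : ℝ) = (N : ℝ) ^ (1/4 : ℝ) := by
    nth_rw 1 [← Real.rpow_one (N : ℝ)]
    rw [← Real.rpow_add hN0]; norm_num
  have head : ‖∑ n ∈ Finset.range N, f (n + 1)‖ ≤ 4 * B * (N : ℝ) ^ (1/4 : ℝ) := by
    calc ‖∑ n ∈ Finset.range N, f (n + 1)‖ ≤ ∑ n ∈ Finset.range N, ‖f (n + 1)‖ := norm_sum_le _ _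
      _ ≤ ∑ n ∈ Finset.range N, B * ((n : ℝ) + 1) ^ (-(3/4) : ℝ) :=
          Finset.sum_le_sum fun n _ => hfb _ (by linarith [(Nat.cast_nonneg n : (0:ℝ) ≤ n)])
      _ = B * ∑ n ∈ Finset.range N, ((n : ℝ) + 1) ^ (-(3/4) : ℝ) := by rw [Finset.mul_sum]
      _ ≤ B * (4 * (N : ℝ) ^ (1/4 : ℝ)) := by gcongr; exact aux_rpow_head N
      _ = _ := by ring
  have hlim : Tendsto (fun k : ℕ => (∑ n ∈ Finset.range (N + k), f (n + 1)) - F ((N + k : ℕ) : ℝ))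
      atTop (nhds (S - 0)) := by
    have ht : Tendsto (fun k : ℕ => N + k) atTop atTop := tendsto_atTop_mono (fun k => by simp) tendsto_id
    exact (hS.tendsto_sum_nat.comp ht).sub
      (hF0.comp (tendsto_natCast_atTop_atTop.comp ht))
  rw [sub_zero] at hlim
  refine le_of_tendsto hlim.norm (Eventually.of_forall fun k => ?_)
  rw [Finset.sum_range_add]
  have e : ∑ n ∈ Finset.range N, f (n + 1) + ∑ n ∈ Finset.range k, f ((N + n : ℕ) + 1) - F ((N + k : ℕ) : ℝ)
    = ∑ n ∈ Finset.range N, f (n + 1) + (∑ n ∈ Finset.range k, f ((N + n : ℕ) + 1) - (F ((N + k : ℕ) : ℝ) - F N)) - F N := by ring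
  rw [e]
  have h3 : (0:ℝ) ≤ ((N + k : ℕ) : ℝ) ^ (-(3/4) : ℝ) := by positivity
  have h4 : A * N * (16/3 * ((N : ℝ) ^ (-(3/4) : ℝ) - ((N + k : ℕ) : ℝ) ^ (-(3/4) : ℝ))) ≤
     6 * A * (N : ℝ) ^ (1/4 : ℝ) := by
    rw [← e14]
    have h5 : 0 ≤ A * N := by positivity
    have h6 := mul_nonneg h5 h3
    have h7 : 0 ≤ A * N * (N : ℝ) ^ (-(3/4) : ℝ) := by positivity
    nlinarith
  refine (norm_sub_le _ _).trans ?_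
  have := (norm_add_le (∑ n ∈ Finset.range N, f (n + 1)) (∑ n ∈ Finset.range k, f ((N + n : ℕ) + 1) - (F ((N + k : ℕ) : ℝ) - F N)))
  linarith [part k]


lemma aux_cpow_deriv (z : ℂ) (u : ℝ) (hu : 1 ≤ u) :
    HasDerivAt (fun v : ℝ => (v : ℂ) ^ z) (z * (u : ℂ) ^ (z - 1)) u := by
  have h := (Complex.hasStrictDerivAt_cpow_const (x := (u : ℂ)) (c := z)
    (Complex.ofReal_mem_slitPlane.2 (by linarith))).hasDerivAt.comp_ofReal
  exact h

lemma aux_log_deriv (u : ℝ) (hu : 1 ≤ u) :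
    HasDerivAt (fun v : ℝ => (Real.log v : ℂ)) ((u : ℂ)⁻¹) u := by
  have h := (Real.hasDerivAt_log (by linarith : u ≠ 0)).ofReal_comp
  simpa using h

lemma aux_norm_cpow (z : ℂ) (u : ℝ) (hu : 1 ≤ u) : ‖(u : ℂ) ^ z‖ = u ^ z.re :=
  Complex.norm_cpow_eq_rpow_re_of_pos (by linarith) z

lemma aux_log_le (u : ℝ) (hu : 1 ≤ u) : Real.log u ≤ 4 * u ^ (1/4 : ℝ) := by
  have := Real.log_le_rpow_div (by linarith : 0 ≤ u) (by norm_num : (0:ℝ) < 1/4)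
  linarith

lemma zeta_hasSum (s : ℂ) (hs : 1 < s.re) :
    HasSum (fun n : ℕ => (((n + 1 : ℝ)) : ℂ) ^ (-s)) (riemannZeta s) := by
  rw [zeta_eq_tsum_one_div_nat_add_one_cpow hs]
  have h := (Complex.summable_one_div_nat_cpow.2 hs)
  have h2 := ((summable_nat_add_iff 1).2 h).hasSum
  have e : (fun n : ℕ => (((n + 1 : ℝ)) : ℂ) ^ (-s)) = fun n : ℕ => 1 / ((n : ℂ) + 1) ^ s := by
    funext n
    rw [Complex.cpow_neg, one_div]; push_cast; rfl
  rw [e]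
  simpa only [Nat.cast_add, Nat.cast_one] using h2

lemma zeta_deriv_hasSum (s : ℂ) (hs : 1 < s.re) :
    HasSum (fun n : ℕ => (Real.log (n + 1 : ℝ) : ℂ) * (((n + 1 : ℝ)) : ℂ) ^ (-s)) (-deriv riemannZeta s) := by
  have hab : LSeries.abscissaOfAbsConv 1 < s.re := by
    rw [LSeries.abscissaOfAbsConv_one]; exact_mod_cast hs
  have h1 := LSeries_deriv hab
  have h2 : deriv riemannZeta s = deriv (LSeries 1) s := by
    apply Filter.EventuallyEq.deriv_eq
    filter_upwards [(isOpen_lt continuous_const Complex.continuous_re).mem_nhds hs] with z hz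
    exact (LSeries_one_eq_riemannZeta hz).symm
  have h3 := (LSeriesSummable_logMul_of_lt_re hab).hasSum
  rw [h2, h1, neg_neg]
  have h4 := (hasSum_nat_add_iff' 1).2 h3
  simp only [Finset.range_one, Finset.sum_singleton, LSeries.term_zero, sub_zero] at h4
  have e : (fun n : ℕ => (Real.log (n + 1 : ℝ) : ℂ) * (((n + 1 : ℝ)) : ℂ) ^ (-s)) =
      fun n : ℕ => LSeries.term (LSeries.logMul 1) s (n + 1) := by
    funext n
    rw [LSeries.term_of_ne_zero (by omega), Complex.ofReal_log (by positivity)]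
    simp [LSeries.logMul, Complex.cpow_neg, div_eq_mul_inv]
  rw [e]
  exact h4

lemma zeta_bounds : ∃ C : ℝ, 0 < C ∧ ∀ η t : ℝ, 0 < η → η ≤ 1 → 1 ≤ |t| →
    ‖riemannZeta (1 + η + Complex.I * t)‖ ≤ C * |t| ^ (1/4 : ℝ) ∧
    ‖deriv riemannZeta (1 + η + Complex.I * t)‖ ≤ C * |t| ^ (1/4 : ℝ) := by
  refine ⟨2 * 200, by norm_num, fun η t h0 h1 ht => ?_⟩
  set s : ℂ := 1 + η + Complex.I * t with hs
  have hre : s.re = 1 + η := by simp [hs]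
  have him : s.im = t := by simp [hs]
  have hs1 : 1 < s.re := by rw [hre]; linarith
  set N := ⌈|t|⌉₊ with hNdef
  have hN1 : 1 ≤ N := Nat.one_le_ceil_iff.2 (by linarith)
  have hNt : |t| ≤ N := Nat.le_ceil _
  have hNt2 : (N : ℝ) ≤ 2 * |t| := by
    have := Nat.ceil_lt_add_one (abs_nonneg t); linarith
  have hN14 : (N : ℝ) ^ (1/4 : ℝ) ≤ 2 * |t| ^ (1/4 : ℝ) := by
    calc (N : ℝ) ^ (1/4 : ℝ) ≤ (2 * |t|) ^ (1/4 : ℝ) := by gcongr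
      _ = 2 ^ (1/4 : ℝ) * |t| ^ (1/4 : ℝ) := Real.mul_rpow (by norm_num) (abs_nonneg t)
      _ ≤ 2 ^ (1 : ℝ) * |t| ^ (1/4 : ℝ) := by
          gcongr <;> norm_num
      _ = _ := by norm_num
  have hNge : (1:ℝ) ≤ (N : ℝ) ^ (1/4 : ℝ) := Real.one_le_rpow (by exact_mod_cast hN1) (by norm_num)
  have hsn : ‖s‖ ≤ 3 * N := by
    have := Complex.norm_le_abs_re_add_abs_im s
    rw [hre, him, abs_of_pos (by linarith)] at this
    linarith
  have hsn1 : 1 ≤ ‖s‖ := by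
    have := Complex.abs_re_le_norm s
    rw [hre, abs_of_pos (by linarith)] at this; linarith
  have hs1n : 1 ≤ ‖1 - s‖ := by
    have := Complex.abs_im_le_norm (1 - s)
    simp [him] at this
    linarith
  have hsne : (1 - s) ≠ 0 := by
    intro h; rw [h] at hs1n; norm_num at hs1n
  have hrp : ∀ u : ℝ, 1 ≤ u → u ^ (-s).re ≤ u ^ (-1 : ℝ) := fun u hu =>
    Real.rpow_le_rpow_of_exponent_le hu (by simp [hre]; linarith)
  have hrp2 : ∀ u : ℝ, 1 ≤ u → u ^ (-s - 1).re ≤ u ^ (-2 : ℝ) := fun u hu =>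
    Real.rpow_le_rpow_of_exponent_le hu (by simp [hre]; linarith)
  have hrp3 : ∀ u : ℝ, 1 ≤ u → u ^ (1 - s).re ≤ 1 := fun u hu =>
    Real.rpow_le_one_of_one_le_of_nonpos hu (by simp [hre]; linarith)
  have hT1 : Tendsto (fun u : ℝ => u ^ (1 - s).re) atTop (nhds 0) := by
    have : (1 - s).re = -η := by simp [hre]
    rw [this]; exact tendsto_rpow_neg_atTop h0
  have hT2 : Tendsto (fun u : ℝ => Real.log u * u ^ (1 - s).re) atTop (nhds 0) := by
    have : (1 - s).re = -η := by simp [hre]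
    rw [this]
    have h := (isLittleO_log_rpow_atTop h0).tendsto_div_nhds_zero
    refine h.congr' ?_
    filter_upwards [eventually_ge_atTop 0] with u hu
    rw [Real.rpow_neg hu, div_eq_mul_inv]
  constructor
  · have := aux_generic (fun u => (u : ℂ) ^ (-s)) (fun u => (u : ℂ) ^ (1 - s) / (1 - s))
      (fun u => (-s) * (u : ℂ) ^ (-s - 1)) N hN1 3 1 1 (by norm_num) (by norm_num)
      (fun u hu => by
        have := (aux_cpow_deriv (1 - s) u hu).div_const (1 - s)
        rw [mul_div_cancel_left₀ _ hsne] at this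
        exact this.congr_deriv (by congr 1; ring))
      (fun u hu => aux_cpow_deriv (-s) u hu)
      (fun u hu => by
        rw [norm_mul, norm_neg, aux_norm_cpow _ u hu]
        have : u ^ (-s - 1).re ≤ u ^ (-(7/4) : ℝ) := (hrp2 u hu).trans
          (Real.rpow_le_rpow_of_exponent_le hu (by norm_num))
        gcongr)
      (fun u hu => by
        rw [aux_norm_cpow _ u hu, one_mul]
        exact (hrp u hu).trans (Real.rpow_le_rpow_of_exponent_le hu (by norm_num)))
      (by
        have hN1' : (1:ℝ) ≤ N := by exact_mod_cast hN1
        rw [norm_div, aux_norm_cpow _ _ hN1']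
        refine (div_le_one_of_le₀ ((hrp3 _ hN1').trans hs1n) (norm_nonneg _)).trans ?_
        linarith)
      (by
        rw [tendsto_zero_iff_norm_tendsto_zero]
        have h := hT1.div_const ‖1 - s‖
        rw [zero_div] at h
        refine h.congr' ?_
        filter_upwards [eventually_ge_atTop 1] with u hu
        rw [norm_div, aux_norm_cpow _ u hu])
      _ (by simpa using zeta_hasSum s hs1)
    linarith
  · have := aux_generic (fun u => (Real.log u : ℂ) * (u : ℂ) ^ (-s))
      (fun u => (Real.log u : ℂ) * ((u : ℂ) ^ (1 - s) / (1 - s)) - (u : ℂ) ^ (1 - s) / (1 - s) ^ 2)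
      (fun u => (u : ℂ)⁻¹ * (u : ℂ) ^ (-s) + (Real.log u : ℂ) * ((-s) * (u : ℂ) ^ (-s - 1)))
      N hN1 15 4 5 (by norm_num) (by norm_num)
      (fun u hu => by
        have hu0 : (u : ℂ) ≠ 0 := by exact_mod_cast (by linarith : u ≠ 0)
        have h1 := (aux_cpow_deriv (1 - s) u hu).div_const (1 - s)
        have h2 := (aux_cpow_deriv (1 - s) u hu).div_const ((1 - s) ^ 2)
        rw [mul_div_cancel_left₀ _ hsne] at h1
        have h3 := ((aux_log_deriv u hu).mul h1).sub h2
        refine h3.congr_deriv ?_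
        have e1 : 1 - s - 1 = -s := by ring
        have e2 : (u : ℂ) ^ (1 - s) = u * (u : ℂ) ^ (-s) := by
          rw [sub_eq_add_neg, Complex.cpow_add _ _ hu0, Complex.cpow_one]
        rw [e1, e2]
        field_simp
        ring)
      (fun u hu => (aux_log_deriv u hu).mul (aux_cpow_deriv (-s) u hu))
      (fun u hu => by
        have hu0 : (0:ℝ) < u := by linarith
        have hl := Real.log_nonneg hu
        refine (norm_add_le _ _).trans ?_
        rw [norm_mul, norm_mul, norm_mul, norm_neg, aux_norm_cpow _ u hu, aux_norm_cpow _ u hu,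
          norm_inv, Complex.norm_real, Complex.norm_real, Real.norm_of_nonneg hl, Real.norm_of_nonneg hu0.le]
        have a1 : u⁻¹ * u ^ (-s).re ≤ u ^ (-(7/4) : ℝ) := by
          calc u⁻¹ * u ^ (-s).re ≤ u⁻¹ * u ^ (-1 : ℝ) := mul_le_mul_of_nonneg_left (hrp u hu) (by positivity)
            _ = u ^ (-2 : ℝ) := by
              rw [← Real.rpow_neg_one, ← Real.rpow_add hu0]; norm_num
            _ ≤ _ := Real.rpow_le_rpow_of_exponent_le hu (by norm_num)
        have a2 : Real.log u * u ^ (-s-1).re ≤ 4 * u ^ (-(7/4) : ℝ) := by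
          calc Real.log u * u ^ (-s-1).re ≤ (4 * u ^ (1/4 : ℝ)) * u ^ (-2 : ℝ) := 
                mul_le_mul (aux_log_le u hu) (hrp2 u hu) (by positivity) (by positivity)
            _ = 4 * u ^ (-(7/4) : ℝ) := by
              rw [mul_assoc, ← Real.rpow_add hu0]; norm_num
        have a3 : Real.log u * (‖s‖ * u ^ (-s-1).re) ≤ ‖s‖ * (4 * u ^ (-(7/4) : ℝ)) := by
          calc _ = ‖s‖ * (Real.log u * u ^ (-s-1).re) := by ring
            _ ≤ _ := by gcongr
        have a4 : (0:ℝ) ≤ u ^ (-(7/4) : ℝ) := by positivity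
        nlinarith)
      (fun u hu => by
        have hu0 : (0:ℝ) < u := by linarith
        have hl := Real.log_nonneg hu
        rw [norm_mul, aux_norm_cpow _ u hu, Complex.norm_real, Real.norm_of_nonneg hl]
        calc Real.log u * u ^ (-s).re ≤ (4 * u ^ (1/4 : ℝ)) * u ^ (-1 : ℝ) := 
                mul_le_mul (aux_log_le u hu) (hrp u hu) (by positivity) (by positivity)
            _ = 4 * u ^ (-(3/4) : ℝ) := by
              rw [mul_assoc, ← Real.rpow_add hu0]; norm_num)
      (by
        have hN1' : (1:ℝ) ≤ N := by exact_mod_cast hN1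
        have hl := Real.log_nonneg hN1'
        refine (norm_sub_le _ _).trans ?_
        rw [norm_mul, norm_div, norm_div, norm_pow, aux_norm_cpow _ _ hN1', Complex.norm_real, Real.norm_of_nonneg hl]
        have b1 := (div_le_one_of_le₀ ((hrp3 _ hN1').trans hs1n) (norm_nonneg _))
        have b2 := (div_le_one_of_le₀ ((hrp3 _ hN1').trans (one_le_pow₀ hs1n : 1 ≤ ‖1-s‖^2)) (by positivity))
        have b3 := aux_log_le _ hN1'
        have b4 := mul_le_of_le_one_right hl b1
        linarith)
      (by
        rw [tendsto_zero_iff_norm_tendsto_zero]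
        have h := (hT2.div_const ‖1 - s‖).add (hT1.div_const (‖1 - s‖^2))
        rw [zero_div, zero_div, zero_add] at h
        refine squeeze_zero' (Eventually.of_forall fun u => norm_nonneg _) ?_ h
        filter_upwards [eventually_ge_atTop 1] with u hu
        have hl := Real.log_nonneg hu
        refine (norm_sub_le _ _).trans ?_
        rw [norm_mul, norm_div, norm_div, norm_pow, aux_norm_cpow _ u hu, Complex.norm_real, Real.norm_of_nonneg hl, mul_div_assoc])
      _ (by simpa using zeta_deriv_hasSum s hs1)
    rw [norm_neg] at this
    linarith


lemma zeta_compact : ∃ c C : ℝ, 0 < c ∧ 0 < C ∧ ∀ η t : ℝ, 0 < η → η ≤ 1 → |t| ≤ 1 →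
    c ≤ ‖riemannZeta (1 + η + Complex.I * t)‖ * ‖(η : ℂ) + Complex.I * t‖ ∧
    ‖riemannZeta (1 + η + Complex.I * t)‖ * ‖(η : ℂ) + Complex.I * t‖ ≤ C := by
  have hK : IsCompact (Set.Icc (1:ℝ) 2 ×ℂ Set.Icc (-1:ℝ) 1) :=
    isCompact_Icc.reProdIm isCompact_Icc
  have hcont : Continuous (fun s => ‖riemannZeta₁ s‖) := differentiable_riemannZeta₁.continuous.norm
  have hne : (Set.Icc (1:ℝ) 2 ×ℂ Set.Icc (-1:ℝ) 1).Nonempty := ⟨1, by simp [Complex.mem_reProdIm]⟩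
  obtain ⟨m, hm, hmin⟩ := hK.exists_isMinOn hne hcont.continuousOn
  obtain ⟨M, hM, hmax⟩ := hK.exists_isMaxOn hne hcont.continuousOn
  have hpos : 0 < ‖riemannZeta₁ m‖ := by
    rw [norm_pos_iff]
    by_cases h : m = 1
    · rw [h]; simp
    · intro h0
      have := riemannZeta_eq_inv_sub_mul h
      rw [h0, mul_zero] at this
      exact riemannZeta_ne_zero_of_one_le_re ((Complex.mem_reProdIm.1 hm).1.1) this
  refine ⟨‖riemannZeta₁ m‖, ‖riemannZeta₁ M‖, hpos, hpos.trans_le (hmin hM), ?_⟩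
  intro η t h0 h1 ht
  set s : ℂ := 1 + η + Complex.I * t with hs
  have hmem : s ∈ (Set.Icc (1:ℝ) 2 ×ℂ Set.Icc (-1:ℝ) 1) := by
    have := abs_le.1 ht
    rw [Complex.mem_reProdIm]
    simp [hs]
    exact ⟨⟨h0.le, by linarith⟩, this⟩
  have hs1 : s ≠ 1 := by
    intro h
    have := congrArg Complex.re h
    simp [hs] at this
    linarith
  have e : ‖riemannZeta s‖ * ‖(η : ℂ) + Complex.I * t‖ = ‖riemannZeta₁ s‖ := by
    have h2 : (η : ℂ) + Complex.I * t = s - 1 := by rw [hs]; ring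
    rw [h2, ← norm_mul, riemannZeta_eq_inv_sub_mul hs1]
    congr 1
    have := sub_ne_zero_of_ne hs1
    field_simp
  rw [e]
  exact ⟨hmin hmem, hmax hmem⟩

lemma zeta_real_bound : ∃ C : ℝ, 0 < C ∧ ∀ η : ℝ, 0 < η → η ≤ 1 →
    ‖riemannZeta (1 + η)‖ ≤ C / η := by
  obtain ⟨c, C, hc, hC, h⟩ := zeta_compact
  refine ⟨C, hC, fun η h0 h1 => ?_⟩
  have := (h η 0 h0 h1 (by simp)).2
  simp only [Complex.ofReal_zero, mul_zero, add_zero, Complex.norm_real, Real.norm_of_nonneg h0.le] at this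
  rwa [le_div_iff₀ h0]

lemma zeta_341 (η t : ℝ) (h0 : 0 < η) :
    1 ≤ ‖riemannZeta (1 + η)‖ ^ 3 * ‖riemannZeta (1 + η + Complex.I * t)‖ ^ 4 *
      ‖riemannZeta (1 + η + Complex.I * (2 * t : ℝ))‖ := by
  have := DirichletCharacter.norm_LFunction_product_ge_one (1 : DirichletCharacter ℂ 1) h0 t
  simp only [DirichletCharacter.LFunctionTrivChar, DirichletCharacter.LFunction_modOne_eq, norm_mul, norm_pow] at this
  convert this using 4
  push_cast; ring

lemma zeta_lower_large : ∃ c : ℝ, 0 < c ∧ ∀ η t : ℝ, 0 < η → η ≤ 1 → 1 ≤ |t| →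
    c / |t| ≤ ‖riemannZeta (1 + η + Complex.I * t)‖ := by
  obtain ⟨B, hB, hb⟩ := zeta_bounds
  obtain ⟨C, hC, hc⟩ := zeta_real_bound
  -- lower bound from 3-4-1
  set c1 : ℝ := (1 / (C ^ 3 * (2 * B))) ^ (1/4 : ℝ) with hc1
  have hc1pos : 0 < c1 := by positivity
  have hc14 : c1 ^ 4 = 1 / (C ^ 3 * (2 * B)) := by
    rw [hc1, ← Real.rpow_natCast, ← Real.rpow_mul (by positivity)]; norm_num
  have key : ∀ η t τ : ℝ, 0 < η → η ≤ 1 → 1 ≤ |t| → τ = |t| ^ (1/4 : ℝ) →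
      c1 ^ 4 * η ^ 3 ≤ ‖riemannZeta (1 + η + Complex.I * t)‖ ^ 4 * τ := by
    intro η t τ h0 h1 ht hτ
    have h341 := zeta_341 η t h0
    have e1 := hc η h0 h1
    have ht2 : 1 ≤ |2 * t| := by rw [abs_mul]; norm_num; linarith
    have e2 := (hb η (2 * t) h0 h1 ht2).1
    have e3 : |2 * t| ^ (1/4 : ℝ) ≤ 2 * τ := by
      rw [abs_mul, abs_two, Real.mul_rpow (by norm_num) (abs_nonneg t), ← hτ]
      have : (2:ℝ) ^ (1/4 : ℝ) ≤ 2 ^ (1:ℝ) := Real.rpow_le_rpow_of_exponent_le (by norm_num) (by norm_num)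
      have hτ0 : 0 ≤ τ := by rw [hτ]; positivity
      rw [Real.rpow_one] at this
      gcongr
    have e4 : ‖riemannZeta (1 + η + Complex.I * (2 * t : ℝ))‖ ≤ B * (2 * τ) :=
      e2.trans (by gcongr)
    have e5 : 1 ≤ (C / η) ^ 3 * ‖riemannZeta (1 + η + Complex.I * t)‖ ^ 4 * (B * (2 * τ)) :=
      h341.trans (by gcongr)
    rw [hc14, div_mul_eq_mul_div, div_le_iff₀ (by positivity)]
    rw [div_pow] at e5
    have h3 : 0 < η ^ 3 := by positivity
    calc 1 * η ^ 3 ≤ (C ^ 3 / η ^ 3 * ‖riemannZeta (1 + η + Complex.I * t)‖ ^ 4 * (B * (2 * τ))) * η ^ 3 := by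
          gcongr
      _ = _ := by field_simp
  set q : ℝ := min 1 (c1 / (2 * B)) with hq
  have hq0 : 0 < q := by positivity
  have hq1 : q ≤ 1 := min_le_left _ _
  have hqB : B * q ≤ c1 / 2 := by
    have : q ≤ c1 / (2 * B) := min_le_right _ _
    rw [le_div_iff₀ (by positivity)] at this
    linarith
  refine ⟨c1 / 2 * q ^ 3, by positivity, fun η t h0 h1 ht => ?_⟩
  set τ : ℝ := |t| ^ (1/4 : ℝ) with hτ
  have hτ1 : 1 ≤ τ := Real.one_le_rpow ht (by norm_num)
  have hτ4 : τ ^ 4 = |t| := by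
    rw [hτ, ← Real.rpow_natCast, ← Real.rpow_mul (by positivity)]; norm_num
  set η0 : ℝ := q ^ 4 / τ ^ 5 with hη0
  have hη00 : 0 < η0 := by positivity
  have hη01 : η0 ≤ 1 := by
    rw [hη0, div_le_one (by positivity)]
    exact (pow_le_one₀ hq0.le hq1).trans (one_le_pow₀ hτ1)
  have key2 : ∀ η : ℝ, η0 ≤ η → η ≤ 1 → c1 * q ^ 3 / τ ^ 4 ≤ ‖riemannZeta (1 + η + Complex.I * t)‖ := by
    intro η ha hb'
    have h := key η t τ (hη00.trans_le ha) hb' ht hτ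
    have h2 : c1 ^ 4 * η0 ^ 3 ≤ ‖riemannZeta (1 + η + Complex.I * t)‖ ^ 4 * τ := le_trans (by gcongr) h
    refine le_of_pow_le_pow_left₀ (n := 4) (by norm_num) (norm_nonneg _) ?_
    have h3 : (c1 * q ^ 3 / τ ^ 4) ^ 4 = c1 ^ 4 * η0 ^ 3 / τ := by
      rw [hη0]; field_simp
    rw [h3, div_le_iff₀ (by positivity)]
    exact h2
  rw [← hτ4]
  rcases le_total η0 η with hle | hle
  · refine le_trans ?_ (key2 η hle h1)
    gcongr
    linarith
  · have h2 := key2 η0 le_rfl hη01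
    have hd : ‖riemannZeta (1 + η0 + Complex.I * t) - riemannZeta (1 + η + Complex.I * t)‖ ≤
        (B * τ) * ‖η0 - η‖ := by
      refine (convex_Icc η η0).norm_image_sub_le_of_norm_hasDerivWithin_le
        (f := fun v : ℝ => riemannZeta (1 + v + Complex.I * t))
        (f' := fun v : ℝ => deriv riemannZeta (1 + v + Complex.I * t))
        (fun v hv => ?_) (fun v hv => ?_) ⟨le_rfl, hle⟩ ⟨hle, le_rfl⟩
      · have hne : (1 + (v:ℂ) + Complex.I * t) ≠ 1 := by
          intro h
          have := congrArg Complex.re h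
          simp at this
          linarith [hv.1]
        have d1 := (differentiableAt_riemannZeta hne).hasDerivAt
        have d2 : HasDerivAt (fun v : ℝ => (1 + (v:ℂ) + Complex.I * t)) 1 v := by
          have h1 : HasDerivAt (fun u : ℝ => (u : ℂ)) 1 v := Complex.ofRealCLM.hasDerivAt
          exact (h1.const_add 1).add_const _
        have d3 := d1.comp v d2
        rw [mul_one] at d3
        exact d3.hasDerivWithinAt
      · exact (hb v t (h0.trans_le hv.1) (hv.2.trans hη01) ht).2
    have h4 : ‖η0 - η‖ ≤ η0 := by
      rw [Real.norm_of_nonneg (by linarith)]; linarith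
    have h5 : (B * τ) * ‖η0 - η‖ ≤ c1 / 2 * q ^ 3 / τ ^ 4 := by
      calc (B * τ) * ‖η0 - η‖ ≤ (B * τ) * η0 := by gcongr
        _ = (B * q) * q ^ 3 / τ ^ 4 := by rw [hη0]; field_simp
        _ ≤ _ := by gcongr
    have h6 := norm_sub_norm_le (riemannZeta (1 + η0 + Complex.I * t)) (riemannZeta (1 + η + Complex.I * t))
    have h7 : c1 * q ^ 3 / τ ^ 4 = c1 / 2 * q ^ 3 / τ ^ 4 + c1 / 2 * q ^ 3 / τ ^ 4 := by ring
    linarith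

lemma zeta_lower : ∃ c : ℝ, 0 < c ∧ ∀ η t : ℝ, 0 < η → η ≤ 1 →
    c ≤ ‖riemannZeta (1 + η + Complex.I * t)‖ * ‖(η : ℂ) + Complex.I * t‖ := by
  obtain ⟨c, C, hc, hC, h⟩ := zeta_compact
  obtain ⟨c', hc', h'⟩ := zeta_lower_large
  refine ⟨min c c', by positivity, fun η t h0 h1 => ?_⟩
  rcases le_total |t| 1 with ht | ht
  · exact (min_le_left _ _).trans (h η t h0 h1 ht).1
  · refine (min_le_right _ _).trans ?_
    have h2 := h' η t h0 h1 ht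
    have h3 : |t| ≤ ‖(η : ℂ) + Complex.I * t‖ := by
      have := Complex.abs_im_le_norm ((η : ℂ) + Complex.I * t)
      simpa using this
    have ht0 : 0 < |t| := by linarith
    calc c' = c' / |t| * |t| := by field_simp
      _ ≤ _ := by gcongr

/-- Sum of `log p / p^σ` over any finite set of primes. -/
lemma prime_log_sum : ∃ C δ : ℝ, 0 < C ∧ 0 < δ ∧ ∀ η : ℝ, 0 < η → η ≤ δ → ∀ S : Finset ℕ,
    (∀ p ∈ S, Nat.Prime p) → ∑ p ∈ S, Real.log p * (p : ℝ) ^ (-(1 + η)) ≤ C / η := by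
  obtain ⟨K, hK⟩ := log_deriv_riemannZeta_add_inv_sub_bounded.bound
  rw [eventually_nhdsWithin_iff, Metric.eventually_nhds_iff] at hK
  obtain ⟨δ, hδ, hK⟩ := hK
  refine ⟨1 + |K|, min (δ/2) 1, by positivity, by positivity, fun η h0 h1 S hS => ?_⟩
  have hη1 : η ≤ 1 := h1.trans (min_le_right _ _)
  have hηδ : η < δ := by linarith [h1.trans (min_le_left _ _)]
  have h2 := hK (y := (1 + η : ℂ)) (by simp [dist_eq_norm, abs_of_pos h0, hηδ])
    (by simp [h0.ne'])
  have hre : 1 < (1 + η : ℂ).re := by simp [h0]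
  have h3 := ArithmeticFunction.LSeries_vonMangoldt_eq_deriv_riemannZeta_div hre
  have hsum := (ArithmeticFunction.LSeriesSummable_vonMangoldt hre).hasSum
  have hsr := Complex.hasSum_re hsum
  have hterm : ∀ n : ℕ, (LSeries.term (fun n => ((ArithmeticFunction.vonMangoldt n : ℝ) : ℂ)) (1 + η) n).re =
      ArithmeticFunction.vonMangoldt n * (n : ℝ) ^ (-(1 + η)) := by
    intro n
    rcases Nat.eq_zero_or_pos n with rfl | hn
    · simp
    rw [LSeries.term_of_ne_zero hn.ne', Real.rpow_neg (by positivity), div_eq_mul_inv]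
    have : ((n : ℂ) ^ (1 + η : ℂ)) = (((n : ℝ) ^ (1 + η) : ℝ) : ℂ) := by
      rw [Complex.ofReal_cpow (by positivity)]; push_cast; rfl
    rw [this, ← Complex.ofReal_inv, ← Complex.ofReal_mul, Complex.ofReal_re]
  have hle : ∑ p ∈ S, Real.log p * (p : ℝ) ^ (-(1 + η)) ≤
      (LSeries (fun n => ((ArithmeticFunction.vonMangoldt n : ℝ) : ℂ)) (1 + η)).re := by
    calc _ = ∑ p ∈ S, (LSeries.term (fun n => ((ArithmeticFunction.vonMangoldt n : ℝ) : ℂ)) (1 + η) p).re := by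
          refine Finset.sum_congr rfl fun p hp => ?_
          rw [hterm, ArithmeticFunction.vonMangoldt_apply_prime (hS p hp)]
      _ ≤ _ := sum_le_hasSum S (fun n _ => by
          rw [hterm]
          exact mul_nonneg ArithmeticFunction.vonMangoldt_nonneg (by positivity)) hsr
  refine hle.trans ?_
  refine (Complex.re_le_norm _).trans ?_
  rw [h3, neg_div, norm_neg]
  have h4 : (1 + (η:ℂ) - 1)⁻¹ = ((η⁻¹ : ℝ) : ℂ) := by push_cast; congr 1; ring
  rw [h4, norm_one, mul_one] at h2
  have h5 := norm_sub_le (deriv riemannZeta (1 + η) / riemannZeta (1 + η) + ((η⁻¹ : ℝ) : ℂ)) ((η⁻¹ : ℝ) : ℂ)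
  rw [add_sub_cancel_right, Complex.norm_real, Real.norm_of_nonneg (by positivity)] at h5
  have h6 : |K| ≤ |K| / η := by
    rw [le_div_iff₀ h0]; exact mul_le_of_le_one_right (abs_nonneg _) hη1
  rw [add_div, one_div]
  linarith [le_abs_self K]
lemma factor_compare (η : ℝ) (h0 : 0 < η) (p : ℕ) (hp : p.Prime) (hpy : (p : ℝ) ^ η ≤ 3) :
    1 - (p : ℝ) ^ (-(1 + η)) ≤ (1 - 1 / (p : ℝ)) *
      Real.exp (6 * η * (Real.log p * (p : ℝ) ^ (-(1 + η)))) := by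
  have hp2 : (2 : ℝ) ≤ p := by exact_mod_cast hp.two_le
  have hp0 : (0 : ℝ) < p := by linarith
  have hl : 0 ≤ Real.log p := Real.log_nonneg (by linarith)
  have e1 : (p : ℝ) ^ (-(1 + η)) * (p : ℝ) ^ η = 1 / p := by
    rw [← Real.rpow_add hp0]
    have : -(1 + η) + η = -1 := by ring
    rw [this, Real.rpow_neg_one, one_div]
  have e2 : 1 - (p : ℝ) ^ (-η) ≤ η * Real.log p := by
    rw [Real.rpow_def_of_pos hp0]
    have := Real.add_one_le_exp (Real.log p * -η)
    linarith
  have e3 : (p : ℝ) ^ (-(1 + η)) = 1 / p * (p : ℝ) ^ (-η) := by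
    rw [one_div, ← Real.rpow_neg_one, ← Real.rpow_add hp0]; congr 1; ring
  have e4 : 1 / (p : ℝ) ≤ 3 * (p : ℝ) ^ (-(1 + η)) := by
    rw [← e1, mul_comm]
    gcongr
  have e5 : 1 / (p : ℝ) ≤ 1 / 2 := one_div_le_one_div_of_le (by norm_num) hp2
  have hexp := Real.add_one_le_exp (6 * η * (Real.log p * (p : ℝ) ^ (-(1 + η))))
  have e6 : 1 / (p : ℝ) * (η * Real.log p) ≤ 3 * η * (Real.log p * (p : ℝ) ^ (-(1 + η))) := by
    calc _ ≤ 3 * (p : ℝ) ^ (-(1 + η)) * (η * Real.log p) := by gcongr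
      _ = _ := by ring
  have e7 : 1 / (p : ℝ) - (p : ℝ) ^ (-(1 + η)) ≤ 1 / (p : ℝ) * (η * Real.log p) := by
    rw [e3]
    have : 0 ≤ 1 / (p : ℝ) := by positivity
    nlinarith
  have e8 : 0 ≤ η * (Real.log p * (p : ℝ) ^ (-(1 + η))) := by positivity
  have e9 : 0 ≤ 1 - 1 / (p : ℝ) := by linarith
  nlinarith [mul_le_mul_of_nonneg_left hexp e9]

lemma ratio_bound (η t : ℝ) (h0 : 0 < η) (S : Finset Nat.Primes) :
    ∏ p ∈ S, (‖1 - ((p : ℕ) : ℂ) ^ (-(1 + η + Complex.I * t))‖ / (1 - ((p : ℕ) : ℝ) ^ (-(1 + η)))) ≤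
      ‖riemannZeta (1 + η)‖ / ‖riemannZeta (1 + η + Complex.I * t)‖ := by
  have hre1 : 1 < (1 + η : ℂ).re := by simp [h0]
  have hre2 : 1 < (1 + η + Complex.I * t : ℂ).re := by simp [h0]
  have H1 : Tendsto _ atTop _ := (riemannZeta_eulerProduct_hasProd hre1)
  have H2 : Tendsto _ atTop _ := (riemannZeta_eulerProduct_hasProd hre2)
  have H := H1.norm.div H2.norm (norm_ne_zero_iff.2 (riemannZeta_ne_zero_of_one_le_re hre2.le))
  have hlt : ∀ p : Nat.Primes, ((p : ℕ) : ℝ) ^ (-(1 + η)) < 1 := fun p =>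
    Real.rpow_lt_one_of_one_lt_of_neg (by exact_mod_cast p.2.one_lt) (by linarith)
  have hge : ∀ p : Nat.Primes, 1 ≤ ‖1 - ((p : ℕ) : ℂ) ^ (-(1 + η + Complex.I * t))‖ /
      (1 - ((p : ℕ) : ℝ) ^ (-(1 + η))) := by
    intro p
    rw [one_le_div (by linarith [hlt p])]
    have h := norm_sub_norm_le 1 (((p : ℕ) : ℂ) ^ (-(1 + η + Complex.I * t)))
    have hre : (-(1 + η + Complex.I * t) : ℂ).re = -(1 + η) := by simp
    rw [Complex.norm_natCast_cpow_of_pos p.2.pos, norm_one, hre] at h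
    exact h
  refine ge_of_tendsto H ?_
  filter_upwards [eventually_ge_atTop S] with S' hS'
  have e : (‖∏ p ∈ S', (1 - ((p : ℕ) : ℂ) ^ (-(1 + η : ℂ)))⁻¹‖ /
      ‖∏ p ∈ S', (1 - ((p : ℕ) : ℂ) ^ (-(1 + η + Complex.I * t)))⁻¹‖) =
      ∏ p ∈ S', (‖1 - ((p : ℕ) : ℂ) ^ (-(1 + η + Complex.I * t))‖ / (1 - ((p : ℕ) : ℝ) ^ (-(1 + η)))) := by
    rw [norm_prod, norm_prod, ← Finset.prod_div_distrib]
    refine Finset.prod_congr rfl fun p _ => ?_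
    have e1 : (1 - ((p : ℕ) : ℂ) ^ (-(1 + η : ℂ))) = ((1 - ((p : ℕ) : ℝ) ^ (-(1 + η)) : ℝ) : ℂ) := by
      push_cast
      rw [Complex.ofReal_cpow (by positivity)]; push_cast; rfl
    rw [norm_inv, norm_inv, e1, Complex.norm_real, Real.norm_of_nonneg (by linarith [hlt p]),
      inv_div_inv]
  refine le_trans ?_ (le_of_eq e.symm)
  refine Finset.prod_le_prod_of_subset_of_one_le hS' (fun p _ => ?_) (fun p _ _ => hge p)
  exact zero_le_one.trans (hge p)

/-- Lemma (Euler-product bound in the proof of Lemma 6.2): for fixed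
`γ ∈ (0,1/2)`, any set of primes `PP`, and `s = 1 + (1+iξ)/(γ log x)`, one has
`|∏_{p > w(x), p ∈ PP} (1 − p^{−s})| ≪_γ |1+iξ| ∏_{w(x) < p < x^γ, p ∈ PP} (1 − 1/p)`
for all sufficiently large `x` and all `ξ ∈ ℝ`. -/
theorem stmt_10 (γ : ℝ) (hγ0 : 0 < γ) (hγ1 : γ < 1 / 2) (w : ℝ → ℝ) (hw : GoodW w) :
    ∃ K : ℝ, 0 < K ∧ ∃ x₀ : ℝ, ∀ PP : Set ℕ, (∀ p ∈ PP, Nat.Prime p) →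
      ∀ x ≥ x₀, ∀ ξ : ℝ,
      ‖∏' p : Nat.Primes,
          (if (p : ℕ) ∈ PP ∧ w x < ((p : ℕ) : ℝ) then
            1 - (((p : ℕ) : ℂ) ^
              (-((1 : ℂ) + (1 + ξ * Complex.I) / ((γ * Real.log x : ℝ) : ℂ))))
          else 1)‖ ≤
        K * ‖(1 : ℂ) + ξ * Complex.I‖ *
          ∏ p ∈ (primesUpTo (x ^ γ)).filter
              (fun p : ℕ => p ∈ PP ∧ w x < (p : ℝ) ∧ (p : ℝ) < x ^ γ),
            (1 - 1 / (p : ℝ)) := by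
  obtain ⟨c, hc, hlow⟩ := zeta_lower
  obtain ⟨C, hC, hup⟩ := zeta_real_bound
  obtain ⟨C', δ, hC', hδ, hlog⟩ := prime_log_sum
  refine ⟨C / c * Real.exp (6 * C'), by positivity, Real.exp ((1 + 1 / δ) / γ), ?_⟩
  intro PP _ x hx ξ
  have hx0 : 0 < x := (Real.exp_pos _).trans_le hx
  set L : ℝ := γ * Real.log x with hL
  have hLge : 1 + 1 / δ ≤ L := by
    have := (Real.le_log_iff_exp_le hx0).2 hx
    rw [div_le_iff₀ hγ0] at this
    rw [hL]; linarith
  have hδ' : 0 < 1 / δ := by positivity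
  have hL0 : 0 < L := by linarith
  set η : ℝ := 1 / L with hη
  have h0 : 0 < η := by positivity
  have h1 : η ≤ 1 := by rw [hη, div_le_one hL0]; linarith
  have h2 : η ≤ δ := by
    rw [hη, div_le_comm₀ hL0 hδ]; linarith
  set t : ℝ := ξ / L with ht
  have hLC : (L : ℂ) ≠ 0 := by exact_mod_cast hL0.ne'
  have hs : (1 : ℂ) + (1 + ξ * Complex.I) / ((L : ℝ) : ℂ) = 1 + η + Complex.I * t := by
    rw [hη, ht]; push_cast; field_simp; ring
  rw [hs]
  have hnorm : ‖(η : ℂ) + Complex.I * t‖ = ‖(1 : ℂ) + ξ * Complex.I‖ * η := by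
    have : (η : ℂ) + Complex.I * t = (1 + ξ * Complex.I) * (η : ℝ) := by
      rw [hη, ht]; push_cast; field_simp
    rw [this, norm_mul, Complex.norm_real, Real.norm_of_nonneg h0.le]
  -- the ratio of zeta values
  have hR : ‖riemannZeta (1 + η)‖ / ‖riemannZeta (1 + η + Complex.I * t)‖ ≤
      C / c * ‖(1 : ℂ) + ξ * Complex.I‖ := by
    have a1 := hlow η t h0 h1
    have a2 := hup η h0 h1
    rw [hnorm] at a1
    have hz : 0 < ‖riemannZeta (1 + η + Complex.I * t)‖ := by
      rw [norm_pos_iff]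
      exact riemannZeta_ne_zero_of_one_le_re (by simp [h0.le])
    rw [div_le_iff₀ hz]
    refine a2.trans ?_
    rw [div_le_iff₀ h0]
    calc C = C / c * c := by field_simp
      _ ≤ C / c * (‖riemannZeta (1 + η + Complex.I * t)‖ * (‖(1 : ℂ) + ξ * Complex.I‖ * η)) := by
          gcongr
      _ = _ := by ring
  set s : ℂ := 1 + η + Complex.I * t with hsdef
  have hsre : (-s).re = -(1 + η) := by simp [hsdef]
  have hpn : ∀ p : Nat.Primes, ‖((p : ℕ) : ℂ) ^ (-s)‖ = ((p : ℕ) : ℝ) ^ (-(1 + η)) := fun p => by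
    rw [Complex.norm_natCast_cpow_of_pos p.2.pos, hsre]
  have hlt : ∀ p : Nat.Primes, ((p : ℕ) : ℝ) ^ (-(1 + η)) < 1 := fun p =>
    Real.rpow_lt_one_of_one_lt_of_neg (by exact_mod_cast p.2.one_lt) (by linarith)
  -- convergence of the product
  have hmult : Multipliable (fun p : Nat.Primes =>
      (if (p : ℕ) ∈ PP ∧ w x < ((p : ℕ) : ℝ) then 1 - (((p : ℕ) : ℂ) ^ (-s)) else 1)) := by
    have hsum : Summable (fun p : Nat.Primes =>
        ‖(if (p : ℕ) ∈ PP ∧ w x < ((p : ℕ) : ℝ) then - (((p : ℕ) : ℂ) ^ (-s)) else 0)‖) := by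
      refine Summable.of_nonneg_of_le (fun _ => norm_nonneg _) (fun p => ?_)
        (Nat.Primes.summable_rpow.2 (by linarith : -(1 + η) < -1))
      split_ifs
      · rw [norm_neg, hpn]
      · rw [norm_zero]; positivity
    refine (multipliable_one_add_of_summable hsum).congr fun p => ?_
    split_ifs <;> ring
  have hT : Tendsto _ atTop _ := hmult.hasProd
  set F := (primesUpTo (x ^ γ)).filter
              (fun p : ℕ => p ∈ PP ∧ w x < (p : ℝ) ∧ (p : ℝ) < x ^ γ) with hF
  have hFp : ∀ p ∈ F, p.Prime := fun p hp => by
    rw [hF, Finset.mem_filter, primesUpTo, Finset.mem_filter] at hp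
    exact hp.1.2
  have hb0 : ∀ p : Nat.Primes, 0 ≤ 1 - ((p : ℕ) : ℝ) ^ (-(1 + η)) := fun p => by linarith [hlt p]
  -- comparison of the finite products
  have hfin : ∏ p ∈ F, (1 - (p : ℝ) ^ (-(1 + η))) ≤
      Real.exp (6 * C') * ∏ p ∈ F, (1 - 1 / (p : ℝ)) := by
    have hone : ∀ p ∈ F, 0 ≤ 1 - 1 / (p : ℝ) := fun p hp => by
      have : (1:ℝ) ≤ p := by exact_mod_cast (hFp p hp).one_lt.le
      rw [sub_nonneg, div_le_one (by linarith)]; exact this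
    calc ∏ p ∈ F, (1 - (p : ℝ) ^ (-(1 + η)))
        ≤ ∏ p ∈ F, ((1 - 1 / (p : ℝ)) * Real.exp (6 * η * (Real.log p * (p : ℝ) ^ (-(1 + η))))) := by
          refine Finset.prod_le_prod (fun p hp => hb0 ⟨p, hFp p hp⟩) fun p hp => ?_
          refine factor_compare η h0 p (hFp p hp) ?_
          have hlt' : (p : ℝ) < x ^ γ := by
            rw [hF, Finset.mem_filter] at hp; exact hp.2.2.2
          have hp0 : (0:ℝ) < p := by exact_mod_cast (hFp p hp).pos
          calc (p : ℝ) ^ η ≤ (x ^ γ) ^ η := by gcongr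
            _ = Real.exp 1 := by
              rw [← Real.rpow_mul hx0.le, Real.rpow_def_of_pos hx0]
              congr 1
              rw [hη, mul_left_comm, ← mul_assoc, ← hL]; field_simp
            _ ≤ 3 := by linarith [Real.exp_one_lt_d9]
      _ = (∏ p ∈ F, (1 - 1 / (p : ℝ))) *
            Real.exp (∑ p ∈ F, 6 * η * (Real.log p * (p : ℝ) ^ (-(1 + η)))) := by
          rw [Finset.prod_mul_distrib, Real.exp_sum]
      _ ≤ (∏ p ∈ F, (1 - 1 / (p : ℝ))) * Real.exp (6 * C') := by
          refine mul_le_mul_of_nonneg_left (Real.exp_le_exp.2 ?_) (Finset.prod_nonneg hone)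
          rw [← Finset.mul_sum]
          calc _ ≤ 6 * η * (C' / η) := by gcongr; exact hlog η h0 h2 F hFp
            _ = _ := by field_simp
      _ = _ := mul_comm _ _
  refine le_of_tendsto hT.norm ?_
  filter_upwards [eventually_ge_atTop (F.subtype Nat.Prime : Finset Nat.Primes)] with S hS
  rw [← Finset.prod_filter, norm_prod]
  set Q := S.filter (fun p : Nat.Primes => (p : ℕ) ∈ PP ∧ w x < ((p : ℕ) : ℝ)) with hQ
  have hsub : (F.subtype Nat.Prime : Finset Nat.Primes) ⊆ Q := by
    intro (p : Nat.Primes) hp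
    refine Finset.mem_filter.2 ⟨hS hp, ?_⟩
    have hp' : (p : ℕ) ∈ F := Finset.mem_subtype.1 hp
    rw [hF, Finset.mem_filter] at hp'
    exact ⟨hp'.2.1, hp'.2.2.1⟩
  calc ∏ p ∈ Q, ‖1 - ((p : ℕ) : ℂ) ^ (-s)‖
      = (∏ p ∈ Q, (‖1 - ((p : ℕ) : ℂ) ^ (-s)‖ / (1 - ((p : ℕ) : ℝ) ^ (-(1 + η))))) *
          ∏ p ∈ Q, (1 - ((p : ℕ) : ℝ) ^ (-(1 + η))) := by
        rw [← Finset.prod_mul_distrib]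
        refine Finset.prod_congr rfl fun p _ => ?_
        rw [div_mul_cancel₀]
        linarith [hlt p]
    _ ≤ (C / c * ‖(1 : ℂ) + ξ * Complex.I‖) * (Real.exp (6 * C') * ∏ p ∈ F, (1 - 1 / (p : ℝ))) := by
        refine mul_le_mul ((ratio_bound η t h0 Q).trans hR) ?_
          (Finset.prod_nonneg fun p _ => hb0 p) (by positivity)
        refine le_trans ?_ hfin
        have e : ∏ p ∈ (F.subtype Nat.Prime : Finset Nat.Primes), (1 - ((p : ℕ) : ℝ) ^ (-(1 + η))) =
            ∏ p ∈ F, (1 - (p : ℝ) ^ (-(1 + η))) :=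
          Finset.prod_subtype_of_mem (fun p : ℕ => (1 - (p : ℝ) ^ (-(1 + η)))) hFp
        rw [← e]
        refine Finset.prod_le_prod_of_subset_of_le_one hsub (fun p _ => hb0 p) (fun p _ _ => ?_)
        have : 0 ≤ ((p : ℕ) : ℝ) ^ (-(1 + η)) := by positivity
        linarith
    _ = _ := by ring

end
end
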